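/- arXiv:math/0703609 — 9 statements merged into one kernel-verified Lean document; each statement's English description precedes it below -/
import Mathlib

section
/- Let C₁ = {(t, t·sin(1/t)) : t ∈ ℝ, t ≠ 0} ∪ {(0,0)} ⊆ ℝ² and let K = {(x,y) ∈ ℝ² : |y| ≤ |x|}. Then for every point z ∈ ℝ², the distance dist(z, c·C₁) converges to dist(z, K) as c → ∞. -/
open Metric Filter Pointwise

/-- Points of the Euclidean plane. -/
noncomputable def pt (a b : ℝ) : EuclideanSpace ℝ (Fin 2) :=
  (EuclideanSpace.equiv (Fin 2) ℝ).symm ![a, b]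

/-- The set `C₁ = {(t, t·sin(1/t)) : t ≠ 0} ∪ {(0,0)} ⊆ ℝ²`. -/
noncomputable def C1 : Set (EuclideanSpace ℝ (Fin 2)) :=
  {z | ∃ t : ℝ, t ≠ 0 ∧ z = pt t (t * Real.sin t⁻¹)} ∪ {pt 0 0}

/-- The cone `K = {(x,y) : |y| ≤ |x|}`. -/
def K : Set (EuclideanSpace ℝ (Fin 2)) := {w | |w 1| ≤ |w 0|}

theorem K_zero_aux {w : EuclideanSpace ℝ (Fin 2)} (hw : w ∈ K) (h0 : w 0 = 0) : w = pt 0 0 := by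
  have h : |w 1| ≤ |w 0| := hw
  rw [h0, abs_zero] at h
  have h1 : w 1 = 0 := abs_eq_zero.mp (le_antisymm h (abs_nonneg _))
  ext i
  fin_cases i
  · simpa [pt] using h0
  · simpa [pt] using h1

theorem smul_C1_subset (c : ℝ) : c • C1 ⊆ K := by
  rintro _ ⟨p, hp, rfl⟩
  rcases hp with ⟨t, -, rfl⟩ | hp
  · have h : |c * (t * Real.sin t⁻¹)| ≤ |c * t| := by
      rw [← mul_assoc, abs_mul]
      exact mul_le_of_le_one_right (abs_nonneg _) (Real.abs_sin_le_one _)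
    simpa [K, pt] using h
  · rw [Set.mem_singleton_iff] at hp
    subst hp
    simp [K, pt]

theorem smul_C1_nonempty (c : ℝ) : (c • C1).Nonempty :=
  ⟨c • pt 0 0, Set.smul_mem_smul_set (Or.inr rfl)⟩

theorem floor_tendsto_aux (θ x : ℝ) :
    Tendsto (fun c : ℝ => (θ + (⌊c * x⁻¹ / (2 * Real.pi)⌋ : ℤ) * (2 * Real.pi)) / c) atTop
      (nhds x⁻¹) := by
  have hpi := Real.pi_pos
  rw [tendsto_iff_dist_tendsto_zero]
  have hlim : Tendsto (fun c : ℝ => (|θ| + 2 * Real.pi) / c) atTop (nhds 0) :=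
    tendsto_const_nhds.div_atTop tendsto_id
  refine squeeze_zero' (Eventually.of_forall fun _ => dist_nonneg) ?_ hlim
  filter_upwards [eventually_gt_atTop 0] with c hc
  set a := c * x⁻¹ / (2 * Real.pi) with ha
  have hca : c * x⁻¹ = a * (2 * Real.pi) := by rw [ha]; field_simp
  have e : (θ + (⌊a⌋ : ℤ) * (2 * Real.pi)) / c - x⁻¹
      = (θ - (a - ⌊a⌋) * (2 * Real.pi)) / c := by
    rw [eq_div_iff hc.ne', sub_mul, div_mul_cancel₀ _ hc.ne', mul_comm x⁻¹ c, hca]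
    ring
  rw [Real.dist_eq, e, abs_div, abs_of_pos hc]
  gcongr
  have h1 := Int.floor_le a
  have h2 := Int.lt_floor_add_one a
  refine (abs_sub _ _).trans ?_
  rw [abs_of_nonneg (a := (a - ⌊a⌋) * (2 * Real.pi)) (by apply mul_nonneg <;> linarith)]
  nlinarith

theorem approx_aux {w : EuclideanSpace ℝ (Fin 2)} (hw : w ∈ K) :
    ∃ p : ℝ → EuclideanSpace ℝ (Fin 2), (∀ᶠ c in atTop, p c ∈ c • C1) ∧
      Tendsto p atTop (nhds w) := by
  by_cases h0 : w 0 = 0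
  · refine ⟨fun _ => w, Eventually.of_forall fun c => ?_, tendsto_const_nhds⟩
    rw [K_zero_aux hw h0]
    refine ⟨pt 0 0, Or.inr rfl, ?_⟩
    ext i
    fin_cases i <;> simp [pt]
  · have h : |w 1| ≤ |w 0| := hw
    have hs : |w 1 / w 0| ≤ 1 := by
      rw [abs_div]; exact div_le_one_of_le₀ h (abs_nonneg _)
    obtain ⟨hs1, hs2⟩ := abs_le.mp hs
    set s := w 1 / w 0 with hsdef
    have hlim := floor_tendsto_aux (Real.arcsin s) (w 0)
    set u : ℝ → ℝ := fun c => Real.arcsin s +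
      (⌊c * (w 0)⁻¹ / (2 * Real.pi)⌋ : ℤ) * (2 * Real.pi) with hu
    have hsin : ∀ c, Real.sin (u c) = s := fun c => by
      rw [hu]
      simp only [Real.sin_add_int_mul_two_pi]
      exact Real.sin_arcsin hs1 hs2
    have hlim' : Tendsto (fun c => u c / c) atTop (nhds (w 0)⁻¹) := hlim
    have hne : ∀ᶠ c in atTop, u c / c ≠ 0 := hlim'.eventually_ne (inv_ne_zero h0)
    have hl2 : Tendsto (fun c => c * (u c)⁻¹) atTop (nhds (w 0)) := by
      have := hlim'.inv₀ (inv_ne_zero h0)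
      rw [inv_inv] at this
      refine this.congr fun c => ?_
      rw [inv_div, div_eq_mul_inv]
    refine ⟨fun c => pt (c * (u c)⁻¹) (c * (u c)⁻¹ * s), ?_, ?_⟩
    · filter_upwards [hne] with c hc
      have huc : u c ≠ 0 := fun h => hc (by rw [h, zero_div])
      refine ⟨_, Or.inl ⟨(u c)⁻¹, inv_ne_zero huc, rfl⟩, ?_⟩
      rw [inv_inv, hsin]
      ext i
      fin_cases i <;> simp [pt, mul_assoc]
    · have hw' : w = pt (w 0) (w 0 * s) := by
        ext i
        fin_cases i
        · simp [pt]
        · simp [pt, hsdef, mul_div_cancel₀, h0]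
      have hcont : Continuous fun a : ℝ => pt a (a * s) := by
        unfold pt
        refine (EuclideanSpace.equiv (Fin 2) ℝ).symm.continuous.comp ?_
        refine continuous_pi fun i => ?_
        fin_cases i
        · exact continuous_id
        · exact continuous_id.mul continuous_const
      have := (hcont.tendsto (w 0)).comp hl2
      rw [← hw'] at this
      exact this

/-- For every `z ∈ ℝ²`, the distance from `z` to the rescaled set `c·C₁` converges, as
`c → ∞`, to the distance from `z` to the cone `K` between the axes `y = ±x`. -/
theorem dist_smul_C1_tendsto (z : EuclideanSpace ℝ (Fin 2)) :
    Tendsto (fun c : ℝ => infDist z (c • C1)) atTop (nhds (infDist z K)) := by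
  have hKne : K.Nonempty := (smul_C1_nonempty 1).mono (smul_C1_subset 1)
  rw [tendsto_order]
  refine ⟨fun a ha => Eventually.of_forall fun c => ha.trans_le
    (infDist_le_infDist_of_subset (smul_C1_subset c) (smul_C1_nonempty c)), fun b hb => ?_⟩
  obtain ⟨w, hwK, hw⟩ := (infDist_lt_iff hKne).mp hb
  obtain ⟨p, hp, hpl⟩ := approx_aux hwK
  have hd : Tendsto (fun c => dist z (p c)) atTop (nhds (dist z w)) := tendsto_const_nhds.dist hpl
  filter_upwards [hp, hd.eventually_lt_const hw] with c hc hlt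
  exact (infDist_le_dist_of_mem hc).trans_lt hlt
end

section
/- Let C₂ = {(t, t·sin(−log(|t|/4))) : t ∈ [−3,3], t ≠ 0} ∪ {(0,0)} ⊆ ℝ². Then there exists a point z ∈ ℝ² such that the function c ↦ dist(z, c·C₂) has no limit as c → ∞ (i.e., there is no real number L with dist(z, c·C₂) → L as c → ∞). -/
open Metric Filter Pointwise

/-- The set `C₂ = {(t, t·sin(−log(|t|/4))) : t ∈ [−3,3], t ≠ 0} ∪ {(0,0)} ⊆ ℝ²`. -/
noncomputable def C2 : Set (EuclideanSpace ℝ (Fin 2)) :=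
  {z | ∃ t : ℝ, t ∈ Set.Icc (-3 : ℝ) 3 ∧ t ≠ 0 ∧
    z = pt t (t * Real.sin (-Real.log (|t| / 4)))} ∪ {pt 0 0}

lemma tendsto_aux (a : ℝ) :
    Tendsto (fun k : ℕ => Real.exp (a + k * (2 * Real.pi)) / 4) atTop atTop := by
  apply Tendsto.atTop_div_const (by norm_num)
  apply Real.tendsto_exp_atTop.comp
  apply tendsto_atTop_add_const_left
  exact tendsto_natCast_atTop_atTop.atTop_mul_const (by positivity)

lemma infDist_zero_aux (k : ℕ) :
    infDist (pt 1 1) ((Real.exp (Real.pi / 2 + k * (2 * Real.pi)) / 4) • C2) = 0 := by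
  set u : ℝ := Real.pi / 2 + k * (2 * Real.pi) with hu
  have hpi := Real.pi_gt_three
  have hk : (0 : ℝ) ≤ k * (2 * Real.pi) := by positivity
  have he := Real.add_one_le_exp u
  have hpos := Real.exp_pos u
  have hlog : Real.log (|4 / Real.exp u| / 4) = -u := by
    rw [abs_of_pos (by positivity)]
    have : 4 / Real.exp u / 4 = Real.exp (-u) := by
      rw [Real.exp_neg]; field_simp
    rw [this, Real.log_exp]
  have hsin : Real.sin u = 1 := by
    rw [hu, Real.sin_add_nat_mul_two_pi, Real.sin_pi_div_two]
  apply infDist_zero_of_mem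
  refine ⟨pt (4 / Real.exp u) (4 / Real.exp u), Or.inl ⟨4 / Real.exp u, ⟨?_, ?_⟩, by positivity, ?_⟩, ?_⟩
  · have : 0 < 4 / Real.exp u := by positivity
    linarith
  · rw [div_le_iff₀ hpos]; linarith
  · rw [hlog, neg_neg, hsin, mul_one]
  · ext i
    fin_cases i <;> simp [pt] <;> field_simp

lemma infDist_ge_aux (k : ℕ) :
    1 / 2 ≤ infDist (pt 1 1) ((Real.exp (-(Real.pi / 2) + k * (2 * Real.pi)) / 4) • C2) := by
  set u : ℝ := -(Real.pi / 2) + k * (2 * Real.pi) with hu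
  have hpos := Real.exp_pos u
  have hne : (((Real.exp u / 4) • C2 : Set (EuclideanSpace ℝ (Fin 2)))).Nonempty :=
    ⟨_, Set.smul_mem_smul_set (Or.inr rfl)⟩
  rw [le_infDist hne]
  rintro _ ⟨y, hy, rfl⟩
  by_contra! hlt
  rw [dist_eq_norm] at hlt
  have h0 := (PiLp.norm_apply_le (pt 1 1 - (Real.exp u / 4) • y) 0).trans_lt hlt
  have h1 := (PiLp.norm_apply_le (pt 1 1 - (Real.exp u / 4) • y) 1).trans_lt hlt
  rcases hy with ⟨t, -, -, rfl⟩ | hy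
  · simp only [pt, EuclideanSpace.equiv, Real.norm_eq_abs] at h0 h1
    simp at h0 h1
    rw [abs_lt] at h0 h1
    obtain ⟨s, hs⟩ : ∃ s, s = Real.exp u / 4 * t := ⟨_, rfl⟩
    rw [← hs] at h0
    have hspos : 0 < s := by linarith
    have ht : t = 4 * s * Real.exp (-u) := by
      rw [hs, Real.exp_neg]; field_simp
    have htpos : 0 < t := by rw [ht]; positivity
    have hlog : Real.log (t / 4) = Real.log s - u := by
      have : t / 4 = s * Real.exp (-u) := by rw [ht]; ring
      rw [this, Real.log_mul hspos.ne' (Real.exp_pos _).ne', Real.log_exp]; ring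
    have hsin : Real.sin (Real.log s - u) = Real.cos (Real.log s) := by
      have : Real.log s - u = Real.log s + Real.pi / 2 - k * (2 * Real.pi) := by rw [hu]; ring
      rw [this, Real.sin_sub_nat_mul_two_pi, Real.sin_add_pi_div_two]
    have hl1 := Real.log_le_sub_one_of_pos hspos
    have hl2 := Real.one_sub_inv_le_log_of_pos hspos
    have hinv : s⁻¹ < 2 := by
      rw [inv_lt_comm₀ hspos (by norm_num)]; linarith
    have hpi := Real.pi_gt_three
    have hcos : 0 < Real.cos (Real.log s) :=
      Real.cos_pos_of_mem_Ioo ⟨by linarith, by linarith⟩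
    rw [abs_of_pos htpos, hlog, hsin] at h1
    have := mul_pos (mul_pos (div_pos hpos four_pos) htpos) hcos
    linarith
  · rw [Set.mem_singleton_iff] at hy
    subst hy
    simp [pt] at h0
    norm_num at h0

/-- There is a point `z ∈ ℝ²` such that `c ↦ dist(z, c·C₂)` has no limit as `c → ∞`. -/
theorem dist_smul_C2_not_tendsto :
    ∃ z : EuclideanSpace ℝ (Fin 2),
      ¬ ∃ L : ℝ, Tendsto (fun c : ℝ => infDist z (c • C2)) atTop (nhds L) := by
  refine ⟨pt 1 1, ?_⟩
  rintro ⟨L, hL⟩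
  have hA := hL.comp (tendsto_aux (Real.pi / 2))
  have hB := hL.comp (tendsto_aux (-(Real.pi / 2)))
  have hL0 : L = 0 := by
    refine tendsto_nhds_unique hA ?_
    refine tendsto_const_nhds.congr fun k => ?_
    exact (infDist_zero_aux k).symm
  have hL1 : 1 / 2 ≤ L := ge_of_tendsto' hB fun k => infDist_ge_aux k
  rw [hL0] at hL1
  norm_num at hL1
end

section
/- Let X = (X₁,…,X_p) be a random vector with multivariate normal distribution N_p(μ,Σ), where Σ is positive definite, and let A, B, C ⊆ {1,…,p} be pairwise disjoint index sets. Then the subvectors X_A and X_B are conditionally independent given X_C if and only if for every i ∈ A and j ∈ B the determinant of the submatrix Σ_{({i}∪C)×({j}∪C)} (rows indexed by {i}∪C, columns by {j}∪C) vanishes: det(Σ_{({i}∪C)×({j}∪C)}) = 0. -/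
open MeasureTheory ProbabilityTheory Matrix

/-- The multivariate normal distribution `N_p(μ, S)` on `ℝ^p` with mean `μ` and positive
definite covariance matrix `S`, defined by its Lebesgue density. -/
noncomputable def mvNormal (p : ℕ) (μ : Fin p → ℝ) (S : Matrix (Fin p) (Fin p) ℝ) :
    Measure (Fin p → ℝ) :=
  MeasureTheory.volume.withDensity fun x =>
    ENNReal.ofReal (Real.exp (-(∑ i, ∑ j, (x i - μ i) * S⁻¹ i j * (x j - μ j)) / 2) /
      Real.sqrt ((2 * Real.pi) ^ p * S.det))

lemma pi_gaussian_density (p : ℕ) :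
    (Measure.pi (fun _ : Fin p ↦ gaussianReal 0 1)) =
      (volume : Measure (Fin p → ℝ)).withDensity
        (fun x => ENNReal.ofReal (∏ i, gaussianPDFReal 0 1 (x i))) := by
  refine Measure.pi_eq fun s hs => ?_
  rw [withDensity_apply _ (MeasurableSet.univ_pi hs), volume_pi, Measure.restrict_pi_pi,
    ← ofReal_integral_eq_lintegral_ofReal, 
    integral_fintype_prod_eq_prod (f := fun _ x => gaussianPDFReal 0 1 x),
    ENNReal.ofReal_prod_of_nonneg]
  · refine Finset.prod_congr rfl fun i _ => ?_
    rw [gaussianReal_apply_eq_integral _ one_ne_zero]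
  · intro i _
    exact integral_nonneg fun x => gaussianPDFReal_nonneg _ _ _
  · exact Integrable.fintype_prod (f := fun _ x => gaussianPDFReal 0 1 x)
      fun i => (integrable_gaussianPDFReal 0 1).integrableOn
  · exact ae_of_all _ fun x => Finset.prod_nonneg fun i _ => gaussianPDFReal_nonneg _ _ _

lemma map_pi_gaussian (p : ℕ) (μ : Fin p → ℝ) (S T : Matrix (Fin p) (Fin p) ℝ)
    (hT : T * T = S) (hTs : Tᵀ = T) (hS : S.det ≠ 0) :
    (Measure.pi (fun _ : Fin p ↦ gaussianReal 0 1)).map (fun x => μ + T *ᵥ x) = mvNormal p μ S := by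
  have hTd : T.det ≠ 0 := by
    intro h; apply hS; rw [← hT, det_mul, h, zero_mul]
  have hTc : Continuous (fun x : Fin p → ℝ => T *ᵥ x) := by fun_prop
  have hmeas : Measurable (fun x : Fin p → ℝ => μ + T *ᵥ x) := by fun_prop
  have hgm : Measurable (fun x : Fin p → ℝ => ENNReal.ofReal
      (Real.exp (-(∑ i, ∑ j, (x i - μ i) * S⁻¹ i j * (x j - μ j)) / 2) /
      Real.sqrt ((2 * Real.pi) ^ p * S.det))) := by fun_prop
  have hcv : ∀ F : (Fin p → ℝ) → ENNReal, Measurable F →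
      ∫⁻ y, F y = ENNReal.ofReal |T.det| * ∫⁻ x, F (μ + T *ᵥ x) := by
    intro F hF
    have h1 := Real.map_matrix_volume_pi_eq_smul_volume_pi hTd
    have h2 : ∫⁻ x, F (μ + T *ᵥ x) = ∫⁻ y, F (μ + y) ∂(Measure.map (toLin' T) volume) := by
      rw [lintegral_map (by fun_prop)]
      · rfl
      · exact hTc.measurable
    rw [h2, h1, lintegral_smul_measure, lintegral_add_left_eq_self F, smul_eq_mul, ← mul_assoc,
      ← ENNReal.ofReal_mul (abs_nonneg _), ← abs_mul, mul_inv_cancel₀ hTd]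
    simp
  have hdens : ∀ x : Fin p → ℝ, ∏ i, gaussianPDFReal 0 1 (x i) = |T.det| *
      (Real.exp (-(∑ i, ∑ j, ((μ + T *ᵥ x) i - μ i) * S⁻¹ i j * ((μ + T *ᵥ x) j - μ j)) / 2) /
      Real.sqrt ((2 * Real.pi) ^ p * S.det)) := by
    intro x
    have hq : ∑ i, ∑ j, ((μ + T *ᵥ x) i - μ i) * S⁻¹ i j * ((μ + T *ᵥ x) j - μ j) =
        ∑ i, x i ^ 2 := by
      have : ∑ i, ∑ j, ((μ + T *ᵥ x) i - μ i) * S⁻¹ i j * ((μ + T *ᵥ x) j - μ j) =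
          (T *ᵥ x) ⬝ᵥ (S⁻¹ *ᵥ (T *ᵥ x)) := by
        simp only [dotProduct, mulVec, Pi.add_apply, add_sub_cancel_left, Finset.mul_sum, mul_assoc]
      rw [this, mulVec_mulVec, ← hT, Matrix.mul_inv_rev, Matrix.mul_assoc,
        Matrix.nonsing_inv_mul _ (Ne.isUnit hTd), Matrix.mul_one]
      nth_rewrite 1 [← hTs]
      rw [mulVec_transpose, ← dotProduct_mulVec, mulVec_mulVec,
        Matrix.mul_nonsing_inv _ (Ne.isUnit hTd), one_mulVec]
      simp [dotProduct, pow_two]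
    rw [hq, ← hT, det_mul, ← abs_mul_abs_self T.det]
    simp only [gaussianPDFReal, Finset.prod_mul_distrib, ← Real.exp_sum]
    rw [Real.sqrt_mul (by positivity) (|T.det| * |T.det|), Real.sqrt_mul_self (abs_nonneg _)]
    have h2 : √((2 * Real.pi) ^ p) = √(2 * Real.pi) ^ p := by
      rw [Real.sqrt_eq_iff_mul_self_eq (by positivity) (by positivity), ← mul_pow,
        Real.mul_self_sqrt (by positivity)]
    rw [h2]
    have h3 : |T.det| ≠ 0 := abs_ne_zero.2 hTd
    have h4 : (√(2 * Real.pi) ^ p) ≠ 0 := by positivity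
    have h5 : ∑ i, -(x i - 0) ^ 2 / (2 * ((1 : NNReal) : ℝ)) = (-∑ i, x i ^ 2) / 2 := by
      simp [neg_div, Finset.sum_div]
    have h6 : ∏ _i : Fin p, (√(2 * Real.pi * ((1 : NNReal) : ℝ)))⁻¹ = (√(2 * Real.pi) ^ p)⁻¹ := by
      rw [Finset.prod_const, NNReal.coe_one, mul_one, inv_pow]
      simp
    rw [h5, h6]
    generalize √(2 * Real.pi) ^ p = a at *
    field_simp
  ext s hs
  rw [Measure.map_apply hmeas hs, pi_gaussian_density, withDensity_apply _ (hmeas hs), mvNormal,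
    withDensity_apply _ hs, ← lintegral_indicator (hmeas hs), ← lintegral_indicator hs,
    hcv _ (hgm.indicator hs)]
  refine Eq.trans ?_ (lintegral_const_mul _ ((hgm.indicator hs).comp hmeas))
  refine lintegral_congr fun x => ?_
  by_cases hx : μ + T *ᵥ x ∈ s
  · rw [Set.indicator_of_mem (by exact hx), Set.indicator_of_mem hx, hdens,
      ENNReal.ofReal_mul (abs_nonneg _)]
  · rw [Set.indicator_of_notMem (by exact hx), Set.indicator_of_notMem hx, mul_zero]

open scoped MatrixOrder in
lemma mvNormal_eq (p : ℕ) (μ : Fin p → ℝ) (S : Matrix (Fin p) (Fin p) ℝ) (hS : S.PosDef) :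
    mvNormal p μ S = (multivariateGaussian (WithLp.toLp 2 μ) S).map (WithLp.ofLp) := by
  have h1 := CFC.sqrt_mul_sqrt_self S hS.posSemidef.nonneg
  have h2 : (CFC.sqrt S)ᵀ = CFC.sqrt S := by
    have := (CFC.sqrt_nonneg S).isSelfAdjoint
    rw [← Matrix.conjTranspose_eq_transpose_of_trivial]
    exact this
  rw [← map_pi_gaussian p μ S _ h1 h2 hS.det_pos.ne', multivariateGaussian, ← map_pi_eq_stdGaussian,
    Measure.map_map (by fun_prop) (by fun_prop), Measure.map_map (by fun_prop) (by fun_prop)]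
  congr 1

lemma law_gauss {p : ℕ} {μ : Fin p → ℝ} {S : Matrix (Fin p) (Fin p) ℝ} (hS : S.PosDef)
    {Ω : Type} [MeasurableSpace Ω] {P : Measure Ω} [IsProbabilityMeasure P]
    {X : Ω → (Fin p → ℝ)} (hX : Measurable X)
    (hlaw : Measure.map X P = mvNormal p μ S) :
    HasGaussianLaw X P ∧ ∀ i j, cov[fun ω => X ω i, fun ω => X ω j; P] = S i j := by
  rw [mvNormal_eq p μ S hS] at hlaw
  constructor
  · constructor
    rw [hlaw]
    exact isGaussian_map (EuclideanSpace.equiv (Fin p) ℝ).toContinuousLinearMap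
  · intro i j
    rw [← covariance_eval_multivariateGaussian (μ := WithLp.toLp 2 μ) hS.posSemidef i j]
    have e1 : cov[fun x => x i, fun x => x j; P.map X] = cov[fun ω => X ω i, fun ω => X ω j; P] :=
      covariance_map_fun (Measurable.aestronglyMeasurable (by fun_prop)) 
       (Measurable.aestronglyMeasurable (by fun_prop)) (by fun_prop)
    rw [← e1, hlaw, covariance_map_fun (Measurable.aestronglyMeasurable (by fun_prop)) 
       (Measurable.aestronglyMeasurable (by fun_prop)) (by fun_prop)]

lemma condIndep_sup_of_condIndep {Ω : Type} {m m₁ m₂ : MeasurableSpace Ω}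
    {mΩ : MeasurableSpace Ω} [StandardBorelSpace Ω]
    {P : Measure Ω} [IsProbabilityMeasure P] (hm : m ≤ mΩ)
    (h₁ : m₁ ≤ mΩ) (h₂ : m₂ ≤ mΩ) (h : CondIndep m m₁ m₂ hm P) :
    CondIndep m (m₁ ⊔ m) (m₂ ⊔ m) hm P := by
  let Q : MeasurableSpace Ω → Set (Set Ω) := fun m' =>
    {u | ∃ t s, MeasurableSet[m'] t ∧ MeasurableSet[m] s ∧ u = t ∩ s}
  have hpi : ∀ m', IsPiSystem (Q m') := by
    rintro m' _ ⟨t, s, ht, hs, rfl⟩ _ ⟨t', s', ht', hs', rfl⟩ -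
    exact ⟨t ∩ t', s ∩ s', ht.inter ht', hs.inter hs', Set.inter_inter_inter_comm _ _ _ _⟩
  have hgen : ∀ m', m' ⊔ m = MeasurableSpace.generateFrom (Q m') := by
    intro m'
    apply le_antisymm
    · refine sup_le (fun t ht => ?_) (fun s hs => ?_)
      · exact MeasurableSpace.measurableSet_generateFrom
          ⟨t, Set.univ, ht, @MeasurableSet.univ _ m, (Set.inter_univ t).symm⟩
      · exact MeasurableSpace.measurableSet_generateFrom
          ⟨Set.univ, s, @MeasurableSet.univ _ m', hs, (Set.univ_inter s).symm⟩
    · refine MeasurableSpace.generateFrom_le ?_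
      rintro _ ⟨t, s, ht, hs, rfl⟩
      exact @MeasurableSet.inter _ (m' ⊔ m) _ _ ((le_sup_left : m' ≤ m' ⊔ m) _ ht)
        ((le_sup_right : m ≤ m' ⊔ m) _ hs)
  have hQm : ∀ m' ≤ mΩ, ∀ s ∈ Q m', MeasurableSet s := by
    rintro m' hm' _ ⟨t, s, ht, hs, rfl⟩
    exact (hm' _ ht).inter (hm _ hs)
  have key : ∀ t s, MeasurableSet t → MeasurableSet[m] s →
      P⟦t ∩ s | m⟧ =ᵐ[P] s.indicator (P⟦t | m⟧) := by
    intro t s ht hs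
    rw [Set.inter_comm, ← Set.indicator_indicator]
    exact condExp_indicator ((integrable_const (1 : ℝ)).indicator ht) hs
  refine CondIndepSets.condIndep (p1 := Q m₁) (p2 := Q m₂) (sup_le h₁ hm) (sup_le h₂ hm) (hpi _)
    (hpi _) (hgen _) (hgen _) ?_
  rw [condIndepSets_iff _ _ _ _ (hQm _ h₁) (hQm _ h₂)]
  rintro _ _ ⟨t, s, ht, hs, rfl⟩ ⟨t', s', ht', hs', rfl⟩
  rw [condIndep_iff _ _ _ _ h₁ h₂] at h
  rw [Set.inter_inter_inter_comm]
  filter_upwards [h t t' ht ht', key _ _ ((h₁ _ ht).inter (h₂ _ ht')) (hs.inter hs'),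
    key _ _ (h₁ _ ht) hs, key _ _ (h₂ _ ht') hs'] with ω e1 e2 e3 e4
  rw [e2, Pi.mul_apply, e3, e4]
  by_cases a : ω ∈ s <;> by_cases b : ω ∈ s' <;> simp [a, b, e1]

lemma condIndepFun_shear {Ω β γ δ β' γ' : Type} {mΩ : MeasurableSpace Ω} [StandardBorelSpace Ω]
    [MeasurableSpace β] [MeasurableSpace γ] [mδ : MeasurableSpace δ] [MeasurableSpace β']
    [MeasurableSpace γ']
    {P : Measure Ω} [IsProbabilityMeasure P] {f : Ω → β} {g : Ω → γ} {k : Ω → δ}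
    (hf : Measurable f) (hg : Measurable g)
    (hm : MeasurableSpace.comap k inferInstance ≤ mΩ)
    (φ : β × δ → β') (ψ : γ × δ → γ') (hφ : Measurable φ) (hψ : Measurable ψ)
    (h : CondIndepFun (MeasurableSpace.comap k inferInstance) hm f g P) :
    CondIndepFun (MeasurableSpace.comap k inferInstance) hm
      (fun ω => φ (f ω, k ω)) (fun ω => ψ (g ω, k ω)) P := by
  rw [condIndepFun_iff_condIndep] at h
  have h2 := condIndep_sup_of_condIndep hm hf.comap_le hg.comap_le h
  have h3 : CondIndepFun (MeasurableSpace.comap k inferInstance) hm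
      (fun ω => (f ω, k ω)) (fun ω => (g ω, k ω)) P := by
    rw [condIndepFun_iff_condIndep]
    convert h2 <;> exact MeasurableSpace.comap_prodMk _ _
  exact h3.comp hφ hψ

lemma condIndepFun_iff_indepFun_of_indep {Ω β γ δ : Type} {mΩ : MeasurableSpace Ω}
    [StandardBorelSpace Ω]
    [MeasurableSpace β] [MeasurableSpace γ] [mδ : MeasurableSpace δ]
    {P : Measure Ω} [IsProbabilityMeasure P] {f : Ω → β} {g : Ω → γ} {k : Ω → δ}
    (hf : Measurable f) (hg : Measurable g)
    (hm : MeasurableSpace.comap k inferInstance ≤ mΩ)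
    (hind : IndepFun (fun ω => (f ω, g ω)) k P) :
    CondIndepFun (MeasurableSpace.comap k inferInstance) hm f g P ↔ IndepFun f g P := by
  have key : ∀ u, MeasurableSet[MeasurableSpace.comap (fun ω => (f ω, g ω)) inferInstance] u →
      P⟦u | MeasurableSpace.comap k inferInstance⟧ =ᵐ[P] fun _ => P.real u := by
    intro u hu
    have hu' := (hf.prodMk hg).comap_le _ hu
    have := condExp_indep_eq (μ := P) (f := u.indicator (fun _ => (1 : ℝ))) (hf.prodMk hg).comap_le hm
      (stronglyMeasurable_const.indicator hu) hind
    rw [integral_indicator_const _ hu'] at this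
    simpa using this
  rw [condIndepFun_iff_condExp_inter_preimage_eq_mul hf hg,
    indepFun_iff_measure_inter_preimage_eq_mul]
  have mf : ∀ s, MeasurableSet s →
      MeasurableSet[MeasurableSpace.comap (fun ω => (f ω, g ω)) inferInstance] (f ⁻¹' s) :=
    fun s hs => ⟨Prod.fst ⁻¹' s, measurable_fst hs, rfl⟩
  have mg : ∀ s, MeasurableSet s →
      MeasurableSet[MeasurableSpace.comap (fun ω => (f ω, g ω)) inferInstance] (g ⁻¹' s) :=
    fun s hs => ⟨Prod.snd ⁻¹' s, measurable_snd hs, rfl⟩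
  refine forall_congr' fun s => forall_congr' fun t => forall_congr' fun hs =>
    forall_congr' fun ht => ?_
  have e1 := key _ (mf s hs)
  have e2 := key _ (mg t ht)
  have e3 := key _ ((mf s hs).inter (mg t ht))
  have e4 : P (f ⁻¹' s ∩ g ⁻¹' t) = P (f ⁻¹' s) * P (g ⁻¹' t) ↔
      P.real (f ⁻¹' s ∩ g ⁻¹' t) = P.real (f ⁻¹' s) * P.real (g ⁻¹' t) := by
    rw [measureReal_def, measureReal_def, measureReal_def, ← ENNReal.toReal_mul,
      ENNReal.toReal_eq_toReal_iff' (by finiteness) (by finiteness)]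
  rw [e4]
  constructor
  · intro h
    obtain ⟨ω, hω⟩ := (h.and (e1.and (e2.and e3))).exists
    obtain ⟨a, b, c, d⟩ := hω
    simp only [d, b, c] at a
    exact a
  · intro h
    filter_upwards [e1, e2, e3] with ω a b c
    rw [c, a, b, h]

lemma det_iff_schur {p : ℕ} {S : Matrix (Fin p) (Fin p) ℝ} (hS : S.PosDef)
    (C : Finset (Fin p)) (i j : Fin p) (hi : i ∉ C) :
    (S.submatrix (fun r : ↥(insert i C) => (r : Fin p))
          (fun r : ↥(insert i C) => if (r : Fin p) = i then j else (r : Fin p))).det = 0 ↔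
    S i j - ∑ c : C, (∑ d : C, S i d * (S.submatrix (fun c : C => (c : Fin p))
      (fun c : C => (c : Fin p)))⁻¹ d c) * S c j = 0 := by
  set D : Matrix C C ℝ := S.submatrix (fun c : C => (c : Fin p)) (fun c : C => (c : Fin p)) with hD
  have hDp : D.PosDef := hS.submatrix Subtype.val_injective
  have hDd : D.det ≠ 0 := hDp.det_pos.ne'
  let _ : Invertible D := Matrix.invertibleOfIsUnitDet D (Ne.isUnit hDd)
  let e0 : Unit ⊕ C → ↥(insert i C) := Sum.elim (fun _ => ⟨i, Finset.mem_insert_self _ _⟩)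
    (fun c => ⟨c, Finset.mem_insert_of_mem c.2⟩)
  have he0 : Function.Bijective e0 := by
    constructor
    · rintro (a | a) (b | b) hab
      · rfl
      · exact absurd (by simpa [e0] using hab) (fun h : i = b => hi (h ▸ b.2))
      · exact absurd (by simpa [e0] using hab) (fun h : (a : Fin p) = i => hi (h ▸ a.2))
      · congr 1
        exact Subtype.ext (by simpa [e0] using hab)
    · rintro ⟨r, hr⟩
      rcases Finset.mem_insert.1 hr with h | h
      · exact ⟨Sum.inl (), Subtype.ext h.symm⟩
      · exact ⟨Sum.inr ⟨r, h⟩, rfl⟩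
  let e := Equiv.ofBijective e0 he0
  rw [← Matrix.det_submatrix_equiv_self e]
  have hblock : ((S.submatrix (fun r : ↥(insert i C) => (r : Fin p))
          (fun r : ↥(insert i C) => if (r : Fin p) = i then j else (r : Fin p))).submatrix e e) =
      Matrix.fromBlocks (Matrix.of fun (_ _ : Unit) => S i j) (Matrix.of fun (_ : Unit) (c : C) => S i c)
        (Matrix.of fun (c : C) (_ : Unit) => S c j) D := by
    have hne : ∀ c : C, (c : Fin p) ≠ i := fun c h => hi (h ▸ c.2)
    ext (a | a) (b | b) <;> simp [e, e0, hD, hne]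
  rw [hblock, Matrix.det_fromBlocks₂₂, mul_eq_zero, or_iff_right hDd, Matrix.det_unique]
  simp [Matrix.mul_apply, Matrix.invOf_eq_nonsing_inv]

theorem gaussian_condIndep_iff_det_vanish
    (p : ℕ) (μ : Fin p → ℝ) (S : Matrix (Fin p) (Fin p) ℝ) (hS : S.PosDef)
    (A B C : Finset (Fin p)) (hAB : Disjoint A B) (hAC : Disjoint A C) (hBC : Disjoint B C)
    (Ω : Type) [MeasurableSpace Ω] [StandardBorelSpace Ω]
    (P : Measure Ω) [IsProbabilityMeasure P]
    (X : Ω → (Fin p → ℝ)) (hX : Measurable X)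
    (hlaw : Measure.map X P = mvNormal p μ S)
    (hm : MeasurableSpace.comap (fun ω => fun i : ↥C => X ω i) inferInstance ≤
      ‹MeasurableSpace Ω›) :
    CondIndepFun (MeasurableSpace.comap (fun ω => fun i : ↥C => X ω i) inferInstance) hm
        (fun ω => fun i : ↥A => X ω i) (fun ω => fun j : ↥B => X ω j) P ↔
      ∀ i ∈ A, ∀ j ∈ B,
        (S.submatrix (fun r : ↥(insert i C) => (r : Fin p))
          (fun r : ↥(insert i C) => if (r : Fin p) = i then j else (r : Fin p))).det = 0 := by
  obtain ⟨hG, hcov⟩ := law_gauss hS hX hlaw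
  set D : Matrix C C ℝ := S.submatrix (fun c : C => (c : Fin p)) (fun c : C => (c : Fin p)) with hD
  have hDp : D.PosDef := hS.submatrix Subtype.val_injective
  have hDd : IsUnit D.det := Ne.isUnit hDp.det_pos.ne'
  let K : Fin p → C → ℝ := fun i c => ∑ d : C, S i d * D⁻¹ d c
  -- the regression residuals, as a linear map
  let L : (Fin p → ℝ) →ₗ[ℝ] (Fin p → ℝ) :=
    { toFun := fun x i => x i - ∑ c : C, K i c * x c
      map_add' := by
        intro x y; ext i
        simp only [Pi.add_apply, mul_add, Finset.sum_add_distrib]; ring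
      map_smul' := by
        intro a x; ext i
        simp only [Pi.smul_apply, smul_eq_mul, RingHom.id_apply, mul_sub, Finset.mul_sum]
        congr 1
        exact Finset.sum_congr rfl fun c _ => by ring }
  have hLm : Measurable (fun x => L x) := L.continuous_of_finiteDimensional.measurable
  let R : Fin p → Ω → ℝ := fun i ω => L (X ω) i
  have hRdef : ∀ i, R i = fun ω => X ω i - ∑ c : C, K i c * X ω c := fun i => rfl
  have hXL2 : ∀ i, MemLp (fun ω => X ω i) 2 P := fun i =>
    (hG.map_fun (ContinuousLinearMap.proj i)).memLp_two
  have hsumL2 : ∀ i, MemLp (fun ω => ∑ c : C, K i c * X ω c) 2 P := fun i =>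
    memLp_finsetSum _ fun c _ => (hXL2 c).const_mul _
  have hRL2 : ∀ i, MemLp (R i) 2 P := fun i => (hXL2 i).sub (hsumL2 i)
  have hleft : ∀ i (Y : Ω → ℝ), MemLp Y 2 P → cov[R i, Y; P] =
      cov[fun ω => X ω i, Y; P] - ∑ c : C, K i c * cov[fun ω => X ω c, Y; P] := by
    intro i Y hY
    rw [hRdef, covariance_fun_sub_left (hXL2 i) (hsumL2 i) hY,
      covariance_fun_sum_left (X := fun (c : C) ω => K i c * X ω c) (fun c => (hXL2 c).const_mul _) hY]
    simp_rw [covariance_const_mul_left]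
  have hRX : ∀ i j, cov[R i, fun ω => X ω j; P] = S i j - ∑ c : C, K i c * S c j := by
    intro i j
    rw [hleft i _ (hXL2 j)]
    simp_rw [hcov]
  have hRC : ∀ i (d : C), cov[R i, fun ω => X ω d; P] = 0 := by
    intro i d
    rw [hRX]
    have h1 : (fun c : C => S i c) ᵥ* D⁻¹ ᵥ* D = fun c : C => S i c := by
      rw [vecMul_vecMul, Matrix.nonsing_inv_mul _ hDd, vecMul_one]
    have h2 := congrFun h1 d
    simp only [vecMul, dotProduct] at h2
    rw [sub_eq_zero, ← h2]
    rfl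
  have hRR : ∀ i j, cov[R i, R j; P] = S i j - ∑ c : C, K i c * S c j := by
    intro i j
    rw [covariance_comm, hleft j _ (hRL2 i), covariance_comm, hRX]
    simp_rw [covariance_comm _ (R i), hRC]
    simp
  have hschur : (∀ i ∈ A, ∀ j ∈ B,
        (S.submatrix (fun r : ↥(insert i C) => (r : Fin p))
          (fun r : ↥(insert i C) => if (r : Fin p) = i then j else (r : Fin p))).det = 0) ↔
      ∀ (i : A) (j : B), cov[R i, R j; P] = 0 := by
    constructor
    · intro h i j
      rw [hRR]
      exact (det_iff_schur hS C i j (Finset.disjoint_left.1 hAC i.2)).1 (h i i.2 j j.2)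
    · intro h i hi j hj
      have := h ⟨i, hi⟩ ⟨j, hj⟩
      rw [hRR] at this
      exact (det_iff_schur hS C i j (Finset.disjoint_left.1 hAC hi)).2 this
  have hRm : ∀ i, Measurable (R i) := fun i => (measurable_pi_apply i).comp (hLm.comp hX)
  -- the residuals are independent of `X_C`
  have hind0 : IndepFun (fun ω i => R i ω) (fun ω (c : C) => X ω c) P := by
    refine HasGaussianLaw.indepFun_of_covariance_eval (X := R) (Y := fun (c : C) ω => X ω c) ?_ hRC
    exact hG.map_fun (LinearMap.toContinuousLinearMap
      (L.prod (LinearMap.funLeft ℝ ℝ (fun c : C => (c : Fin p)))))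
  have hind : IndepFun (fun ω => ((fun i : A => R i ω), (fun j : B => R j ω)))
      (fun ω (c : C) => X ω c) P :=
    hind0.comp (φ := fun r => ((fun i : A => r i), (fun j : B => r j))) (ψ := id)
      (by fun_prop) measurable_id
  have hXA : Measurable (fun ω (i : A) => X ω i) := by fun_prop
  have hXB : Measurable (fun ω (i : B) => X ω i) := by fun_prop
  have hRA : Measurable (fun ω (i : A) => R i ω) := measurable_pi_lambda _ fun i => hRm i
  have hRB : Measurable (fun ω (i : B) => R i ω) := measurable_pi_lambda _ fun i => hRm i
  have h1 : CondIndepFun (MeasurableSpace.comap (fun ω => fun i : ↥C => X ω i) inferInstance) hm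
        (fun ω => fun i : ↥A => X ω i) (fun ω => fun j : ↥B => X ω j) P ↔
      CondIndepFun (MeasurableSpace.comap (fun ω => fun i : ↥C => X ω i) inferInstance) hm
        (fun ω => fun i : ↥A => R i ω) (fun ω => fun j : ↥B => R j ω) P := by
    constructor
    · intro h
      exact condIndepFun_shear hXA hXB hm
        (fun q (i : A) => q.1 i - ∑ c : C, K i c * q.2 c)
        (fun q (i : B) => q.1 i - ∑ c : C, K i c * q.2 c) (by fun_prop) (by fun_prop) h
    · intro h
      have := condIndepFun_shear hRA hRB hm
        (fun q (i : A) => q.1 i + ∑ c : C, K i c * q.2 c)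
        (fun q (i : B) => q.1 i + ∑ c : C, K i c * q.2 c) (by fun_prop) (by fun_prop) h
      simpa only [hRdef, sub_add_cancel] using this
  rw [h1, condIndepFun_iff_indepFun_of_indep hRA hRB hm hind, hschur]
  constructor
  · intro h i j
    have h2 : IndepFun (R i) (R j) P :=
      h.comp (φ := fun r : A → ℝ => r i) (ψ := fun r : B → ℝ => r j) (by fun_prop) (by fun_prop)
    exact h2.covariance_eq_zero (hRL2 i) (hRL2 j)
  · intro h
    refine HasGaussianLaw.indepFun_of_covariance_eval (X := fun (i : A) => R i)
      (Y := fun (j : B) => R j) ?_ h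
    exact hG.map_fun (LinearMap.toContinuousLinearMap
      (((LinearMap.funLeft ℝ ℝ (fun c : A => (c : Fin p))).prod
        (LinearMap.funLeft ℝ ℝ (fun c : B => (c : Fin p)))) ∘ₗ L))
end

section
/- Fix p ≥ 1 and pairwise disjoint sets A, B, C ⊆ {1,…,p}. Let S be the set of all symmetric positive definite p×p real matrices Σ such that every (|C|+1)×(|C|+1) minor of the submatrix Σ_{(A∪C)×(B∪C)} vanishes. Regard each such minor as a polynomial in the variables σ_{ij}, 1 ≤ i ≤ j ≤ p (identifying σ_{ji} with σ_{ij}). Then the vanishing ideal I(S) ⊆ ℝ[σ_{ij} : 1 ≤ i ≤ j ≤ p] equals the ideal generated by all the (|C|+1)×(|C|+1) minors of Σ_{(A∪C)×(B∪C)}. -/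
open MvPolynomial Matrix

/-- Variables `σ_{ij}`, `1 ≤ i ≤ j ≤ p`, of the polynomial ring attached to symmetric
`p × p` matrices. -/
abbrev SymVar (p : ℕ) := {q : Fin p × Fin p // q.1 ≤ q.2}

/-- The variable `σ_{ij}` (identifying `σ_{ji}` with `σ_{ij}`) as a polynomial. -/
noncomputable def svar {p : ℕ} (i j : Fin p) : MvPolynomial (SymVar p) ℝ :=
  MvPolynomial.X ⟨(min i j, max i j), min_le_max⟩

namespace GCI

/-- The unordered pair `{i, j}` as an index of a variable. -/
def mk {p : ℕ} (i j : Fin p) : SymVar p := ⟨(min i j, max i j), min_le_max⟩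

lemma mk_comm {p : ℕ} (i j : Fin p) : mk i j = mk j i := by
  simp [mk, min_comm, max_comm]

lemma mk_self {p : ℕ} (e : SymVar p) : mk e.1.1 e.1.2 = e := by
  rcases e with ⟨⟨i, j⟩, h⟩
  simp only [mk, Subtype.mk.injEq, Prod.mk.injEq]
  exact ⟨min_eq_left h, max_eq_right h⟩

lemma svar_eq {p : ℕ} (i j : Fin p) : svar i j = MvPolynomial.X (mk i j) := rfl

/-- symmetric functions of the end points -/
lemma mk_fun {p : ℕ} {α : Type*} (F : Fin p → Fin p → α) (hF : ∀ i j, F i j = F j i)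
    (i j : Fin p) : F (mk i j).1.1 (mk i j).1.2 = F i j := by
  rcases le_total i j with h | h
  · simp [mk, h]
  · simp [mk, h, hF i j]

/-- Lower end point with respect to the position function. -/
def lo {p : ℕ} (pos : Fin p → ℕ) (e : SymVar p) : Fin p :=
  if pos e.1.1 ≤ pos e.1.2 then e.1.1 else e.1.2

/-- Upper end point with respect to the position function. -/
def hi {p : ℕ} (pos : Fin p → ℕ) (e : SymVar p) : Fin p :=
  if pos e.1.1 ≤ pos e.1.2 then e.1.2 else e.1.1

lemma lo_le_hi {p : ℕ} (pos : Fin p → ℕ) (e : SymVar p) : pos (lo pos e) ≤ pos (hi pos e) := by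
  unfold lo hi
  split_ifs <;> omega

lemma mk_lo_hi {p : ℕ} (pos : Fin p → ℕ) (e : SymVar p) : mk (lo pos e) (hi pos e) = e := by
  unfold lo hi
  split_ifs
  · exact mk_self e
  · rw [mk_comm]; exact mk_self e

/-- weight of an edge -/
def ew {p : ℕ} (pos : Fin p → ℕ) (e : SymVar p) : ℕ := pos e.1.1 * pos e.1.2

lemma ew_mk {p : ℕ} (pos : Fin p → ℕ) (i j : Fin p) : ew pos (mk i j) = pos i * pos j :=
  mk_fun (fun i j => pos i * pos j) (fun _ _ => mul_comm _ _) i j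

/-- weight of a monomial -/
noncomputable def wt {p : ℕ} (pos : Fin p → ℕ) : (SymVar p →₀ ℕ) →+ ℕ := Finsupp.weight (ew pos)

lemma wt_single {p : ℕ} (pos : Fin p → ℕ) (i j : Fin p) :
    wt pos (Finsupp.single (mk i j) 1) = pos i * pos j := by
  rw [wt, Finsupp.weight_single, one_smul, ew_mk]

/-- degree of an edge -/
noncomputable def ed {p : ℕ} (e : SymVar p) : Fin p →₀ ℕ :=
  Finsupp.single e.1.1 1 + Finsupp.single e.1.2 1

lemma ed_mk {p : ℕ} (i j : Fin p) :
    ed (mk i j) = Finsupp.single i 1 + Finsupp.single j 1 :=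
  mk_fun (fun i j => Finsupp.single i 1 + Finsupp.single j 1) (fun _ _ => add_comm _ _) i j

/-- vertex degrees of a monomial -/
noncomputable def vd {p : ℕ} : (SymVar p →₀ ℕ) →+ (Fin p →₀ ℕ) := Finsupp.weight ed

lemma vd_single {p : ℕ} (i j : Fin p) :
    vd (Finsupp.single (mk i j) 1) = Finsupp.single i 1 + Finsupp.single j 1 := by
  rw [vd, Finsupp.weight_single, one_smul, ed_mk]

/-- antichain condition -/
def Anti {p : ℕ} (pos : Fin p → ℕ) (m : SymVar p →₀ ℕ) : Prop :=
  ∀ e ∈ m.support, ∀ e' ∈ m.support,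
    ¬ (pos (lo pos e) < pos (lo pos e') ∧ pos (hi pos e) < pos (hi pos e'))

lemma vd_mem {p : ℕ} (m : SymVar p →₀ ℕ) (v : Fin p) :
    v ∈ (vd m).support ↔ ∃ e ∈ m.support, v = e.1.1 ∨ v = e.1.2 := by
  have : vd m v = ∑ e, m e * ed e v := by
    rw [vd, Finsupp.weight_eq_sum, Finsupp.finsetSum_apply]; rfl
  rw [Finsupp.mem_support_iff, this, Ne, Finset.sum_eq_zero_iff]
  simp only [Finset.mem_univ, true_imp_iff, mul_eq_zero, not_forall, not_or,
    Finsupp.mem_support_iff]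
  refine exists_congr fun e => ?_
  refine and_congr Iff.rfl ?_
  simp only [ed, Finsupp.add_apply, Finsupp.single_apply]
  split_ifs <;> simp_all [eq_comm]

lemma vd_mem' {p : ℕ} (pos : Fin p → ℕ) (m : SymVar p →₀ ℕ) (v : Fin p) :
    v ∈ (vd m).support ↔ ∃ e ∈ m.support, v = lo pos e ∨ v = hi pos e := by
  rw [vd_mem]
  refine exists_congr fun e => and_congr Iff.rfl ?_
  unfold lo hi
  split_ifs <;> tauto

lemma anti_edge {p : ℕ} {pos : Fin p → ℕ} (hpos : Function.Injective pos) {m : SymVar p →₀ ℕ}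
    (hm : Anti pos m) {v V : Fin p} (hv : v ∈ (vd m).support) (hV : V ∈ (vd m).support)
    (hvm : ∀ x ∈ (vd m).support, pos v ≤ pos x) (hVm : ∀ x ∈ (vd m).support, pos x ≤ pos V) :
    mk v V ∈ m.support := by
  obtain ⟨e, he, hev⟩ := (vd_mem' pos m v).1 hv
  obtain ⟨e', he', heV⟩ := (vd_mem' pos m V).1 hV
  have h1 : lo pos e = v := by
    apply hpos
    apply le_antisymm _ (hvm _ ((vd_mem' pos m _).2 ⟨e, he, Or.inl rfl⟩))
    rcases hev with h | h
    · rw [h]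
    · rw [h]; exact lo_le_hi pos e
  have h2 : hi pos e' = V := by
    apply hpos
    apply le_antisymm (hVm _ ((vd_mem' pos m _).2 ⟨e', he', Or.inr rfl⟩))
    rcases heV with h | h
    · rw [h]; exact lo_le_hi pos e'
    · rw [h]
  have h3 := hm e he e' he'
  rw [h1, h2] at h3
  have h4 := hvm _ ((vd_mem' pos m _).2 ⟨e', he', Or.inl rfl⟩)
  have h5 := hVm _ ((vd_mem' pos m _).2 ⟨e, he, Or.inr rfl⟩)
  by_cases h6 : lo pos e' = v
  · rw [← h6, ← h2, mk_lo_hi]; exact he'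
  · have h7 : hi pos e = V := by
      by_contra h8
      have q1 : pos (lo pos e') ≠ pos v := fun h => h6 (hpos h)
      have q2 : pos (hi pos e) ≠ pos V := fun h => h8 (hpos h)
      omega
    rw [← h1, ← h7, mk_lo_hi]; exact he

lemma exists_sub {p : ℕ} {m : SymVar p →₀ ℕ} {e : SymVar p} (he : e ∈ m.support) :
    ∃ m1, m = m1 + Finsupp.single e 1 := by
  refine ⟨m - Finsupp.single e 1, (tsub_add_cancel_of_le ?_).symm⟩
  rw [Finsupp.single_le_iff]
  rw [Finsupp.mem_support_iff] at he
  omega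

lemma Anti.mono {p : ℕ} {pos : Fin p → ℕ} {m m1 : SymVar p →₀ ℕ} (hm : Anti pos m)
    (h : m1 ≤ m) : Anti pos m1 := by
  have hs : m1.support ⊆ m.support := Finsupp.support_mono h
  exact fun e he e' he' => hm e (hs he) e' (hs he')

lemma anti_unique {p : ℕ} {pos : Fin p → ℕ} (hpos : Function.Injective pos) (n : ℕ) :
    ∀ (m m' : SymVar p →₀ ℕ), m.degree = n → Anti pos m → Anti pos m' → vd m' = vd m →
    m' = m := by
  induction n with
  | zero =>
    intro m m' hn hm hm' h
    rw [Finsupp.degree_eq_zero_iff] at hn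
    subst hn
    by_contra h0
    obtain ⟨e, he⟩ := Finsupp.support_nonempty_iff.2 h0
    have := (vd_mem m' e.1.1).2 ⟨e, he, Or.inl rfl⟩
    rw [h] at this
    simp at this
  | succ n ih =>
    intro m m' hn hm hm' h
    have h0 : m ≠ 0 := by
      rintro rfl
      simp at hn
    obtain ⟨e, he⟩ := Finsupp.support_nonempty_iff.2 h0
    have hne : (vd m).support.Nonempty := ⟨e.1.1, (vd_mem m _).2 ⟨e, he, Or.inl rfl⟩⟩
    obtain ⟨v, hv, hvm⟩ := Finset.exists_min_image _ pos hne
    obtain ⟨V, hV, hVm⟩ := Finset.exists_max_image _ pos hne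
    have a1 := anti_edge hpos hm hv hV hvm hVm
    rw [← h] at hv hV hvm hVm
    have a2 := anti_edge hpos hm' hv hV hvm hVm
    obtain ⟨m1, rfl⟩ := exists_sub a1
    obtain ⟨m2, rfl⟩ := exists_sub a2
    rw [ih m1 m2 ?_ (hm.mono le_self_add) (hm'.mono le_self_add) ?_]
    · rw [map_add, Finsupp.degree_single] at hn
      omega
    · rw [map_add, map_add] at h
      exact add_right_cancel h

lemma anti_min {p : ℕ} {pos : Fin p → ℕ} (hpos : Function.Injective pos)
    {m : SymVar p →₀ ℕ} (hm : Anti pos m) (n : ℕ) :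
    ∀ m' : SymVar p →₀ ℕ, wt pos m' = n → vd m' = vd m → wt pos m' ≤ wt pos m → m' = m := by
  induction n using Nat.strong_induction_on with
  | _ n ih =>
  intro m' hn hv hw
  by_cases hm' : Anti pos m'
  · exact anti_unique hpos _ m m' rfl hm hm' hv
  exfalso
  unfold Anti at hm'
  push Not at hm'
  obtain ⟨e, he, e', he', h1, h2⟩ := hm'
  obtain ⟨m1, rfl⟩ := exists_sub he
  have hne : e' ≠ e := by
    rintro rfl
    exact lt_irrefl _ h1
  have he1 : e' ∈ m1.support := by
    rw [Finsupp.mem_support_iff] at he' ⊢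
    rwa [Finsupp.add_apply, Finsupp.single_eq_of_ne hne, add_zero] at he'
  obtain ⟨m2, rfl⟩ := exists_sub he1
  set i := lo pos e
  set j := hi pos e
  set i' := lo pos e'
  set j' := hi pos e'
  have r1 : mk i j = e := mk_lo_hi pos e
  have r2 : mk i' j' = e' := mk_lo_hi pos e'
  rw [← r1, ← r2] at hv hw hn
  have key : wt pos (m2 + Finsupp.single (mk i j') 1 + Finsupp.single (mk i' j) 1) <
      wt pos (m2 + Finsupp.single (mk i' j') 1 + Finsupp.single (mk i j) 1) := by
    simp only [map_add, wt_single]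
    nlinarith
  have := ih _ (hn ▸ key) _ rfl (by
    rw [← hv]
    simp only [map_add, vd_single]
    abel) (key.le.trans hw)
  rw [this] at key
  omega

end GCI

namespace GCI

open Classical in
lemma mirsky {α : Type*} (R : α → α → Prop) (c : ℕ) : ∀ E : Finset α,
    (∃ x : Fin (c + 1) → α, (∀ k, x k ∈ E) ∧ ∀ k : Fin c, R (x k.castSucc) (x k.succ)) ∨
    ∃ col : α → ℕ, (∀ e ∈ E, col e < c) ∧ ∀ e ∈ E, ∀ e' ∈ E, col e = col e' → ¬ R e e' := by
  induction c with
  | zero =>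
    intro E
    rcases E.eq_empty_or_nonempty with rfl | ⟨e, he⟩
    · exact Or.inr ⟨fun _ => 0, by simp⟩
    · exact Or.inl ⟨fun _ => e, fun _ => he, fun k => k.elim0⟩
  | succ c ih =>
    intro E
    rcases ih (E.filter fun e => ∃ y ∈ E, R y e) with ⟨x, hx, hR⟩ | ⟨col, hc, hR⟩
    · left
      obtain ⟨y, hy, hyR⟩ := (Finset.mem_filter.1 (hx 0)).2
      refine ⟨Fin.cons y x, ?_, ?_⟩
      · intro k
        refine Fin.cases ?_ (fun k => ?_) k
        · simpa using hy
        · simpa using (Finset.mem_filter.1 (hx k)).1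
      · intro k
        refine Fin.cases ?_ (fun k => ?_) k
        · simpa using hyR
        · simpa using hR k
    · right
      refine ⟨fun e => if ∃ y ∈ E, R y e then col e else c, ?_, ?_⟩
      · intro e he
        show (if ∃ y ∈ E, R y e then col e else c) < c + 1
        split_ifs with h
        · exact (hc e (Finset.mem_filter.2 ⟨he, h⟩)).trans (Nat.lt_succ_self c)
        · exact Nat.lt_succ_self c
      · intro e he e' he' heq hee
        have h' : ∃ y ∈ E, R y e' := ⟨e, he, hee⟩
        simp only [if_pos h'] at heq
        have hlt := hc e' (Finset.mem_filter.2 ⟨he', h'⟩)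
        split_ifs at heq with h
        · exact hR e (Finset.mem_filter.2 ⟨he, h⟩) e' (Finset.mem_filter.2 ⟨he', h'⟩) heq hee
        · omega

/-- a `(c+1)`-chain in the support of a monomial -/
def IsChn {p : ℕ} (pos : Fin p → ℕ) (Rw Cl : Finset (Fin p)) {c : ℕ} (m : SymVar p →₀ ℕ)
    (x : Fin (c + 1) → SymVar p) : Prop :=
  (∀ k, x k ∈ m.support) ∧ (∀ k, lo pos (x k) ∈ Rw) ∧ (∀ k, hi pos (x k) ∈ Cl) ∧
    StrictMono (fun k => pos (lo pos (x k))) ∧ StrictMono (fun k => pos (hi pos (x k)))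

/-- the ideal of minors -/
noncomputable def minorIdeal {p : ℕ} (Rw Cl : Finset (Fin p)) (c : ℕ) :
    Ideal (MvPolynomial (SymVar p) ℝ) :=
  Ideal.span {g : MvPolynomial (SymVar p) ℝ |
          ∃ r s : Fin (c + 1) → Fin p, Function.Injective r ∧ Function.Injective s ∧
            (∀ a, r a ∈ Rw) ∧ (∀ a, s a ∈ Cl) ∧
            g = (Matrix.of fun a b => svar (r a) (s b)).det}

lemma perm_lt {n : ℕ} (f g : Fin n → ℕ) (hf : StrictMono f) (hg : StrictMono g)
    (τ : Equiv.Perm (Fin n)) (hτ : τ ≠ 1) :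
    ∑ i, f (τ i) * g i < ∑ i, f i * g i := by
  have h : Monovary (fun i => (f i : ℤ)) (fun i => (g i : ℤ)) := by
    intro i j hij
    have : g i < g j := Int.ofNat_lt.1 hij
    have := hf.monotone (hg.lt_iff_lt.1 this).le
    exact Int.ofNat_le.2 this
  have key := (h.sum_comp_perm_mul_lt_sum_mul_iff (σ := τ)).2 ?_
  · exact_mod_cast key
  · intro hm
    apply hτ
    have h1 : StrictMono (f ∘ τ) := by
      intro i j hij
      have : f (τ i) ≤ f (τ j) := by
        have := @hm i j (Int.ofNat_lt.2 (hg hij))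
        exact Int.ofNat_le.1 this
      refine lt_of_le_of_ne this fun he => ?_
      exact hij.ne (τ.injective (hf.injective he))
    have h2 : f ∘ τ = f := by
      refine (StrictMono.range_inj h1 hf).1 ?_
      rw [Set.range_comp, τ.surjective.range_eq, Set.image_univ]
    ext i
    have := hf.injective (congrFun h2 i)
    simp [this]

lemma reduce_mon {p : ℕ} (pos : Fin p → ℕ) (Rw Cl : Finset (Fin p)) (c : ℕ) (n : ℕ) :
    ∀ m : SymVar p →₀ ℕ, wt pos m = n → (monomial m (1 : ℝ)) ∈
      (minorIdeal Rw Cl c).restrictScalars ℝ ⊔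
      Submodule.span ℝ {g | ∃ m' : SymVar p →₀ ℕ,
        (¬ ∃ x : Fin (c + 1) → SymVar p, IsChn pos Rw Cl m' x) ∧ g = monomial m' (1 : ℝ)} := by
  induction n using Nat.strong_induction_on with
  | _ n ih =>
  intro m hn
  by_cases hx : ∃ x : Fin (c + 1) → SymVar p, IsChn pos Rw Cl m x
  swap
  · exact Submodule.mem_sup_right (Submodule.subset_span ⟨m, hx, rfl⟩)
  obtain ⟨x, hxm, hxr, hxc, hr, hs⟩ := hx
  have hxinj : Function.Injective x := fun a b hab => hr.injective (by simp only [hab])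
  have hle : ∑ k, Finsupp.single (x k) 1 ≤ m := by
    intro e
    rw [Finsupp.finsetSum_apply]
    by_cases he : ∃ k, x k = e
    · obtain ⟨k, rfl⟩ := he
      rw [Finset.sum_eq_single k]
      · rw [Finsupp.single_eq_same]
        have := Finsupp.mem_support_iff.1 (hxm k)
        omega
      · intro b _ hb
        exact Finsupp.single_eq_of_ne (fun h => hb (hxinj h).symm)
      · simp
    · rw [Finset.sum_eq_zero]
      · exact Nat.zero_le _
      · intro b _
        exact Finsupp.single_eq_of_ne (fun h => he ⟨b, h.symm⟩)
  obtain ⟨m0, rfl⟩ := exists_add_of_le hle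
  set r := fun k => lo pos (x k) with hrdef
  set s := fun k => hi pos (x k) with hsdef
  have hxe : ∀ k, x k = mk (r k) (s k) := fun k => (mk_lo_hi pos (x k)).symm
  let N : Equiv.Perm (Fin (c + 1)) → SymVar p →₀ ℕ :=
    fun τ => ∑ k, Finsupp.single (mk (r (τ k)) (s k)) 1 + m0
  have hN1 : N 1 = ∑ k, Finsupp.single (x k) 1 + m0 := by
    simp only [N, hxe, Equiv.Perm.one_apply]
  have hNw : ∀ τ, wt pos (N τ) = ∑ k, pos (r (τ k)) * pos (s k) + wt pos m0 := by
    intro τ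
    simp only [N, map_add, map_sum, wt_single]
  have hNlt : ∀ τ, τ ≠ 1 → wt pos (N τ) < wt pos (N 1) := by
    intro τ hτ
    rw [hNw, hNw]
    have := perm_lt (fun k => pos (r k)) (fun k => pos (s k)) hr hs τ hτ
    simp only [Equiv.Perm.one_apply]
    omega
  have hD : (Matrix.of fun a b => svar (r a) (s b)).det ∈ minorIdeal Rw Cl c := by
    apply Ideal.subset_span
    refine ⟨r, s, ?_, ?_, hxr, hxc, rfl⟩
    · exact fun a b hab => hr.injective (congrArg pos hab)
    · exact fun a b hab => hs.injective (congrArg pos hab)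
  have hexp : monomial m0 (1 : ℝ) * (Matrix.of fun a b => svar (r a) (s b)).det =
      ∑ τ : Equiv.Perm (Fin (c + 1)),
        ((Equiv.Perm.sign τ : ℤ) : ℝ) • monomial (N τ) (1 : ℝ) := by
    rw [Matrix.det_apply', Finset.mul_sum]
    refine Finset.sum_congr rfl fun τ _ => ?_
    have : ∏ i, (Matrix.of fun a b => svar (r a) (s b)) (τ i) i =
        monomial (∑ k, Finsupp.single (mk (r (τ k)) (s k)) 1) (1 : ℝ) := by
      rw [monomial_sum_one]
      rfl
    rw [this, smul_eq_C_mul]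
    have h2 : monomial (N τ) (1 : ℝ) = monomial m0 (1 : ℝ) *
        monomial (∑ k, Finsupp.single (mk (r (τ k)) (s k)) 1) (1 : ℝ) := by
      rw [monomial_mul, one_mul, add_comm]
    rw [h2, map_intCast]
    ring
  rw [← hN1] at hn ⊢
  rw [← Finset.add_sum_erase _ _ (Finset.mem_univ 1)] at hexp
  simp only [Equiv.Perm.sign_one, Units.val_one, Int.cast_one, one_smul] at hexp
  rw [eq_sub_of_add_eq hexp.symm]
  refine Submodule.sub_mem _ (Submodule.mem_sup_left ?_) (Submodule.sum_mem _ fun τ hτ => ?_)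
  · exact Ideal.mul_mem_left _ _ hD
  · refine Submodule.smul_mem _ _ (ih _ ?_ _ rfl)
    rw [← hn]
    exact hNlt τ (Finset.ne_of_mem_erase hτ)

lemma reduce {p : ℕ} (pos : Fin p → ℕ) (Rw Cl : Finset (Fin p)) (c : ℕ)
    (f : MvPolynomial (SymVar p) ℝ) :
    ∃ g, f - g ∈ minorIdeal Rw Cl c ∧ ∀ m ∈ g.support,
      ¬ ∃ x : Fin (c + 1) → SymVar p, IsChn pos Rw Cl m x := by
  have hf : f ∈ (minorIdeal Rw Cl c).restrictScalars ℝ ⊔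
      Submodule.span ℝ {g | ∃ m' : SymVar p →₀ ℕ,
        (¬ ∃ x : Fin (c + 1) → SymVar p, IsChn pos Rw Cl m' x) ∧ g = monomial m' (1 : ℝ)} := by
    rw [f.as_sum]
    refine Submodule.sum_mem _ fun m _ => ?_
    have : monomial m (coeff m f) = coeff m f • monomial m (1 : ℝ) := by
      rw [smul_monomial, smul_eq_mul, mul_one]
    rw [this]
    exact Submodule.smul_mem _ _ (reduce_mon pos Rw Cl c _ m rfl)
  obtain ⟨y, hy, g, hg, rfl⟩ := Submodule.mem_sup.1 hf
  refine ⟨g, by simpa using hy, ?_⟩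
  clear hf hy y
  induction hg using Submodule.span_induction with
  | mem g hg =>
    obtain ⟨m', hm', rfl⟩ := hg
    intro m hm
    have := support_monomial_subset hm
    rw [Finset.mem_singleton] at this
    rwa [this]
  | zero => simp
  | add a b _ _ ha hb =>
    intro m hm
    rcases Finset.mem_union.1 (support_add hm) with h | h
    · exact ha m h
    · exact hb m h
  | smul t a _ ha =>
    intro m hm
    exact ha m (support_smul hm)

end GCI

namespace GCI

/-- nonnegative coefficients, positive at `μ` -/
def Dom {τ : Type*} (P : MvPolynomial τ ℝ) (μ : τ →₀ ℕ) : Prop :=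
  (∀ ν, 0 ≤ coeff ν P) ∧ 0 < coeff μ P

lemma Dom.mul {τ : Type*} {P Q : MvPolynomial τ ℝ} {μ ν : τ →₀ ℕ} (hP : Dom P μ) (hQ : Dom Q ν) :
    Dom (P * Q) (μ + ν) := by
  classical
  constructor
  · intro ξ
    rw [coeff_mul]
    exact Finset.sum_nonneg fun x _ => mul_nonneg (hP.1 _) (hQ.1 _)
  · rw [coeff_mul]
    refine lt_of_lt_of_le (mul_pos hP.2 hQ.2) ?_
    exact Finset.single_le_sum (f := fun x : (τ →₀ ℕ) × (τ →₀ ℕ) => coeff x.1 P * coeff x.2 Q)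
      (fun x _ => mul_nonneg (hP.1 _) (hQ.1 _))
      (Finset.HasAntidiagonal.mem_antidiagonal.2 (rfl : (μ, ν).1 + (μ, ν).2 = μ + ν))

lemma Dom.one {τ : Type*} : Dom (1 : MvPolynomial τ ℝ) 0 := by
  classical
  constructor
  · intro ν
    rw [coeff_one]
    split_ifs <;> norm_num
  · simp

lemma Dom.prod {τ ι : Type*} (s : Finset ι) (P : ι → MvPolynomial τ ℝ) (μ : ι → τ →₀ ℕ)
    (h : ∀ i ∈ s, Dom (P i) (μ i)) : Dom (∏ i ∈ s, P i) (∑ i ∈ s, μ i) := by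
  classical
  induction s using Finset.induction_on with
  | empty => simpa using Dom.one
  | insert a s ha ih =>
    rw [Finset.prod_insert ha, Finset.sum_insert ha]
    exact (h a (Finset.mem_insert_self a s)).mul
      (ih fun i hi => h i (Finset.mem_insert_of_mem hi))

lemma Dom.pow {τ : Type*} {P : MvPolynomial τ ℝ} {μ : τ →₀ ℕ} (h : Dom P μ) (n : ℕ) :
    Dom (P ^ n) (n • μ) := by
  have := Dom.prod (Finset.range n) (fun _ => P) (fun _ => μ) (fun _ _ => h)
  simpa using this

section Split

variable {σ τ κ : Type*} [Fintype κ]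

open Classical in
/-- substitution of a variable by a sum of monomials indexed by the allowed colours -/
noncomputable def sub (al : σ → κ → Prop) (ν : κ → σ → τ →₀ ℕ) (e : σ) : MvPolynomial τ ℝ :=
  ∑ k, if al e k then monomial (ν k e) 1 else 0

lemma sub_dom (al : σ → κ → Prop) (ν : κ → σ → τ →₀ ℕ) (e : σ) (k : κ) (h : al e k) :
    Dom (sub al ν e) (ν k e) := by
  classical
  have hnn : ∀ (k : κ) (ξ : τ →₀ ℕ),
      0 ≤ coeff ξ (if al e k then monomial (ν k e) (1 : ℝ) else 0) := by
    intro k ξ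
    split_ifs
    · rw [coeff_monomial]
      split_ifs <;> norm_num
    · simp
  constructor
  · intro ξ
    rw [sub, coeff_sum]
    exact Finset.sum_nonneg fun k _ => hnn k ξ
  · rw [sub, coeff_sum]
    refine lt_of_lt_of_le ?_ (Finset.single_le_sum (f := fun k' : κ =>
      coeff (ν k e) (if al e k' then monomial (ν k' e) (1 : ℝ) else 0))
      (fun k' _ => hnn k' _) (Finset.mem_univ k))
    simp [h]

lemma split_pos (al : σ → κ → Prop) (ν : κ → σ → τ →₀ ℕ) (n : κ → σ →₀ ℕ)
    (hn : ∀ k, ∀ e ∈ (n k).support, al e k) :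
    Dom (aeval (sub al ν) (monomial (∑ k, n k) (1 : ℝ))) (∑ k, Finsupp.weight (ν k) (n k)) := by
  rw [monomial_sum_one, map_prod]
  refine Dom.prod _ _ _ fun k _ => ?_
  rw [aeval_monomial, map_one, one_mul, Finsupp.weight_apply]
  refine Dom.prod _ _ _ fun e he => ?_
  exact (sub_dom al ν e k (hn k e he)).pow _

/-- Being a splitting of the monomial `m` with total degree `μ`. -/
def IsSplit (al : σ → κ → Prop) (ν : κ → σ → τ →₀ ℕ) (m : σ →₀ ℕ) (μ : τ →₀ ℕ) : Prop :=
  ∃ n : κ → σ →₀ ℕ, (∀ k, ∀ e ∈ (n k).support, al e k) ∧ ∑ k, n k = m ∧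
    ∑ k, Finsupp.weight (ν k) (n k) = μ

lemma IsSplit.add {al : σ → κ → Prop} {ν : κ → σ → τ →₀ ℕ} {m m' : σ →₀ ℕ} {μ μ' : τ →₀ ℕ}
    (h : IsSplit al ν m μ) (h' : IsSplit al ν m' μ') : IsSplit al ν (m + m') (μ + μ') := by
  classical
  obtain ⟨n, h1, rfl, rfl⟩ := h
  obtain ⟨n', h1', rfl, rfl⟩ := h'
  refine ⟨fun k => n k + n' k, ?_, Finset.sum_add_distrib, ?_⟩
  · intro k e he
    rcases Finset.mem_union.1 (Finsupp.support_add he) with h | h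
    · exact h1 k e h
    · exact h1' k e h
  · simp [Finset.sum_add_distrib]

lemma coeff_mul_split {al : σ → κ → Prop} {ν : κ → σ → τ →₀ ℕ} {m m' : σ →₀ ℕ}
    {P Q : MvPolynomial τ ℝ} (hP : ∀ μ, coeff μ P ≠ 0 → IsSplit al ν m μ)
    (hQ : ∀ μ, coeff μ Q ≠ 0 → IsSplit al ν m' μ) :
    ∀ μ, coeff μ (P * Q) ≠ 0 → IsSplit al ν (m + m') μ := by
  classical
  intro μ h
  rw [coeff_mul] at h
  obtain ⟨x, hx, hne⟩ := Finset.exists_ne_zero_of_sum_ne_zero h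
  rw [← Finset.HasAntidiagonal.mem_antidiagonal.1 hx]
  exact (hP _ (left_ne_zero_of_mul hne)).add (hQ _ (right_ne_zero_of_mul hne))

lemma split_of_coeff (al : σ → κ → Prop) (ν : κ → σ → τ →₀ ℕ) (m : σ →₀ ℕ) :
    ∀ μ, coeff μ (aeval (sub al ν) (monomial m (1 : ℝ))) ≠ 0 → IsSplit al ν m μ := by
  classical
  have h0 : ∀ μ, coeff μ (1 : MvPolynomial τ ℝ) ≠ 0 → IsSplit al ν 0 μ := by
    intro μ h
    rw [coeff_one] at h
    split_ifs at h with h'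
    · subst h'
      exact ⟨fun _ => 0, by simp, by simp, by simp⟩
    · exact absurd rfl h
  induction m using Finsupp.induction_linear with
  | zero => simpa using h0
  | add a b ha hb =>
    have : monomial (a + b) (1 : ℝ) = monomial a 1 * monomial b 1 := by simp
    rw [this, map_mul]
    exact coeff_mul_split ha hb
  | single e n =>
    rw [aeval_monomial, map_one, one_mul, Finsupp.prod_single_index (h := fun i k => sub al ν i ^ k) (pow_zero _)]
    induction n with
    | zero => simpa using h0
    | succ n ih =>
      rw [pow_succ, Finsupp.single_add]
      refine coeff_mul_split ih ?_
      intro μ h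
      rw [sub, coeff_sum] at h
      obtain ⟨k, -, hk⟩ := Finset.exists_ne_zero_of_sum_ne_zero h
      split_ifs at hk with hal
      · rw [coeff_monomial] at hk
        split_ifs at hk with hμ
        · subst hμ
          refine ⟨fun k' => if k' = k then Finsupp.single e 1 else 0, ?_, by simp, ?_⟩
          · intro k' e' he'
            beta_reduce at he'
            split_ifs at he' with hkk
            · have := Finsupp.support_single_subset he'
              rw [Finset.mem_singleton] at this
              rw [this, hkk]; exact hal
            · simp at he'
          · rw [Finset.sum_eq_single k]
            · simp [Finsupp.weight_single]
            · intro b _ hb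
              simp [hb]
            · simp
        · exact absurd rfl hk
      · simp at hk

end Split

end GCI

namespace GCI

/-- target variables -/
abbrev TVar (c p : ℕ) := (Fin c × Fin p) ⊕ SymVar p

/-- ladder variables -/
def Lad {p : ℕ} (pos : Fin p → ℕ) (Rw Cl : Finset (Fin p)) (e : SymVar p) : Prop :=
  lo pos e ∈ Rw ∧ hi pos e ∈ Cl

/-- allowed colours -/
def alw {p : ℕ} (pos : Fin p → ℕ) (Rw Cl : Finset (Fin p)) (c : ℕ) (e : SymVar p) :
    Option (Fin c) → Prop
  | none => ¬ Lad pos Rw Cl e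
  | some _ => Lad pos Rw Cl e

/-- monomials substituted -/
noncomputable def nu {c p : ℕ} : Option (Fin c) → SymVar p → TVar c p →₀ ℕ
  | none, e => Finsupp.single (Sum.inr e) 1
  | some k, e => Finsupp.single (Sum.inl (k, e.1.1)) 1 + Finsupp.single (Sum.inl (k, e.1.2)) 1

lemma weight_apply' {c p : ℕ} (k : Option (Fin c)) (m : SymVar p →₀ ℕ) (x : TVar c p) :
    Finsupp.weight (nu k) m x = ∑ e, m e * nu k e x := by
  rw [Finsupp.weight_eq_sum, Finsupp.finsetSum_apply]; rfl

lemma sum_weight_inr {c p : ℕ} (n : Option (Fin c) → SymVar p →₀ ℕ) (e : SymVar p) :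
    (∑ k, Finsupp.weight (nu k) (n k)) (Sum.inr e) = n none e := by
  rw [Finsupp.finsetSum_apply, Fintype.sum_option]
  simp only [weight_apply']
  simp [nu, Finsupp.single_apply]

lemma sum_weight_inl {c p : ℕ} (n : Option (Fin c) → SymVar p →₀ ℕ) (k : Fin c) (v : Fin p) :
    (∑ k, Finsupp.weight (nu k) (n k)) (Sum.inl (k, v)) = vd (n (some k)) v := by
  have : vd (n (some k)) v = ∑ e, n (some k) e * ed e v := by
    rw [vd, Finsupp.weight_eq_sum, Finsupp.finsetSum_apply]; rfl
  rw [Finsupp.finsetSum_apply, Fintype.sum_option, this]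
  simp only [weight_apply']
  rw [Finset.sum_eq_single k]
  · simp [nu, ed, Finsupp.single_apply]
  · intro b _ hb
    simp [nu, hb]
  · simp

open Classical in
lemma indep {p : ℕ} {pos : Fin p → ℕ} (hpos : Function.Injective pos)
    (Rw Cl : Finset (Fin p)) (c : ℕ) (g : MvPolynomial (SymVar p) ℝ)
    (hg : ∀ m ∈ g.support, ¬ ∃ x : Fin (c + 1) → SymVar p, IsChn pos Rw Cl m x)
    (h0 : aeval (sub (alw pos Rw Cl c) nu) g = 0) : g = 0 := by
  by_contra hne
  obtain ⟨m, hm, hmax⟩ := Finset.exists_max_image g.support (wt pos)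
    (Finset.nonempty_of_ne_empty (by simpa using hne))
  have hstd := hg m hm
  rcases mirsky (fun e e' => pos (lo pos e) < pos (lo pos e') ∧ pos (hi pos e) < pos (hi pos e'))
    c (m.support.filter (Lad pos Rw Cl)) with ⟨x, hx, hR⟩ | ⟨col, hc, hR⟩
  · apply hstd
    refine ⟨x, fun k => (Finset.mem_filter.1 (hx k)).1, fun k => (Finset.mem_filter.1 (hx k)).2.1,
      fun k => (Finset.mem_filter.1 (hx k)).2.2, ?_, ?_⟩
    · exact Fin.strictMono_iff_lt_succ.2 fun k => (hR k).1
    · exact Fin.strictMono_iff_lt_succ.2 fun k => (hR k).2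
  let n : Option (Fin c) → SymVar p →₀ ℕ := fun k => match k with
    | none => m.filter (fun e => ¬ Lad pos Rw Cl e)
    | some k => m.filter (fun e => Lad pos Rw Cl e ∧ col e = k)
  have hnal : ∀ k, ∀ e ∈ (n k).support, alw pos Rw Cl c e k := by
    intro k e he
    cases k with
    | none =>
      simp only [n, Finsupp.support_filter, Finset.mem_filter] at he
      exact he.2
    | some k =>
      simp only [n, Finsupp.support_filter, Finset.mem_filter] at he
      exact he.2.1
  have hnsum : ∑ k, n k = m := by
    ext e
    rw [Finsupp.finsetSum_apply, Fintype.sum_option]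
    simp only [n, Finsupp.filter_apply]
    by_cases hL : Lad pos Rw Cl e
    · by_cases hme : m e = 0
      · simp [hme]
      · have hlt := hc e (Finset.mem_filter.2 ⟨Finsupp.mem_support_iff.2 hme, hL⟩)
        rw [Finset.sum_eq_single ⟨col e, hlt⟩]
        · simp [hL]
        · intro b _ hb
          have : ¬ (col e = b) := fun h => hb (Fin.ext h.symm)
          simp [this]
        · simp
    · simp [hL]
  have hanti : ∀ k, Anti pos (n (some k)) := by
    intro k e he e' he'
    simp only [n, Finsupp.support_filter, Finset.mem_filter] at he he'
    exact hR e (Finset.mem_filter.2 ⟨he.1, he.2.1⟩) e' (Finset.mem_filter.2 ⟨he'.1, he'.2.1⟩)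
      (he.2.2.trans he'.2.2.symm)
  have hdom := split_pos (alw pos Rw Cl c) nu n hnal
  rw [hnsum] at hdom
  set μ := ∑ k, Finsupp.weight (nu k) (n k) with hμ
  have huniq : ∀ m' ∈ g.support, m' ≠ m →
      coeff μ (aeval (sub (alw pos Rw Cl c) nu) (monomial m' (1 : ℝ))) = 0 := by
    intro m' hm' hmm
    by_contra hco
    obtain ⟨n', -, hs', hμ'⟩ := split_of_coeff _ _ _ _ hco
    apply hmm
    have hnone : n' none = n none := by
      ext e
      have := DFunLike.congr_fun hμ' (Sum.inr e)
      rwa [hμ, sum_weight_inr, sum_weight_inr] at this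
    have hvd : ∀ k, vd (n' (some k)) = vd (n (some k)) := by
      intro k
      ext v
      have := DFunLike.congr_fun hμ' (Sum.inl (k, v))
      rwa [hμ, sum_weight_inl, sum_weight_inl] at this
    have hw := hmax m' hm'
    rw [← hs', ← hnsum, map_sum, map_sum, Fintype.sum_option, Fintype.sum_option, hnone] at hw
    have hle : ∀ k ∈ (Finset.univ : Finset (Fin c)),
        wt pos (n (some k)) ≤ wt pos (n' (some k)) := by
      intro k _
      by_contra hlt
      push Not at hlt
      have := anti_min hpos (hanti k) _ _ rfl (hvd k) hlt.le
      rw [this] at hlt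
      exact lt_irrefl _ hlt
    have heq := (Finset.sum_eq_sum_iff_of_le hle).1
      (le_antisymm (Finset.sum_le_sum hle) (by omega))
    rw [← hs', ← hnsum]
    refine Finset.sum_congr rfl fun k _ => ?_
    cases k with
    | none => exact hnone
    | some k =>
      exact anti_min hpos (hanti k) _ _ rfl (hvd k) (heq k (Finset.mem_univ k)).ge
  have hexp : coeff μ (aeval (sub (alw pos Rw Cl c) nu) g) = ∑ m' ∈ g.support,
      coeff m' g * coeff μ (aeval (sub (alw pos Rw Cl c) nu) (monomial m' (1 : ℝ))) := by
    conv_lhs => rw [g.as_sum]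
    rw [map_sum, coeff_sum]
    refine Finset.sum_congr rfl fun m' _ => ?_
    have : monomial m' (coeff m' g) = coeff m' g • monomial m' (1 : ℝ) := by
      rw [smul_monomial, smul_eq_mul, mul_one]
    rw [this, map_smul, coeff_smul, smul_eq_mul]
  rw [h0, coeff_zero, Finset.sum_eq_single m] at hexp
  · rcases mul_eq_zero.1 hexp.symm with h | h
    · exact (mem_support_iff.1 hm) h
    · exact hdom.2.ne' h
  · intro m' hm' hne'
    rw [huniq m' hm' hne', mul_zero]
  · intro h
    exact absurd hm h

open Classical in
/-- matrix attached to a point -/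
noncomputable def ptM {c p : ℕ} (pos : Fin p → ℕ) (Rw Cl : Finset (Fin p)) (z : TVar c p → ℝ) :
    Matrix (Fin p) (Fin p) ℝ := Matrix.of fun i j =>
  if Lad pos Rw Cl (mk i j) then ∑ k, z (Sum.inl (k, i)) * z (Sum.inl (k, j))
  else z (Sum.inr (mk i j))

lemma ptM_symm {c p : ℕ} (pos : Fin p → ℕ) (Rw Cl : Finset (Fin p)) (z : TVar c p → ℝ) :
    (ptM pos Rw Cl z).IsSymm := by
  ext i j
  simp only [ptM, Matrix.transpose_apply, Matrix.of_apply]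
  rw [mk_comm j i]
  congr 1
  exact Finset.sum_congr rfl fun k _ => mul_comm _ _

lemma eval_sub {c p : ℕ} (pos : Fin p → ℕ) (Rw Cl : Finset (Fin p)) (z : TVar c p → ℝ)
    (f : MvPolynomial (SymVar p) ℝ) :
    eval (fun v => ptM pos Rw Cl z v.1.1 v.1.2) f =
      eval z (aeval (sub (alw pos Rw Cl c) nu) f) := by
  have : (aeval z : MvPolynomial (TVar c p) ℝ →ₐ[ℝ] ℝ).comp (aeval (sub (alw pos Rw Cl c) nu)) =
      aeval (fun v : SymVar p => ptM pos Rw Cl z v.1.1 v.1.2) := by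
    apply MvPolynomial.algHom_ext
    intro e
    classical
    rw [AlgHom.comp_apply, aeval_X, aeval_X, sub, Fintype.sum_option, map_add, map_sum]
    simp only [ptM, Matrix.of_apply, mk_self]
    by_cases hL : Lad pos Rw Cl e
    · simp [alw, hL, nu, aeval_monomial, Finsupp.prod_add_index', pow_add]
    · simp [alw, hL, nu, aeval_monomial]
  have h2 := DFunLike.congr_fun this f
  simpa [aeval_eq_eval] using h2.symm

lemma posDef_near {p : ℕ} (M : Matrix (Fin p) (Fin p) ℝ) (hs : M.IsSymm)
    (h : ∀ i j, |M i j - (1 : Matrix (Fin p) (Fin p) ℝ) i j| < 1 / ((p : ℝ) + 1)) : M.PosDef := by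
  refine Matrix.PosDef.of_dotProduct_mulVec_pos ?_ ?_
  · rw [Matrix.IsHermitian, Matrix.conjTranspose_eq_transpose_of_trivial]; exact hs
  intro x hx
  set ε : ℝ := 1 / ((p : ℝ) + 1) with hε
  have hsq : 0 < ∑ i, x i ^ 2 := by
    obtain ⟨i, hi⟩ := Function.ne_iff.1 hx
    refine lt_of_lt_of_le (b := x i ^ 2) ?_
      (Finset.single_le_sum (f := fun i => x i ^ 2) (fun i _ => sq_nonneg _) (Finset.mem_univ i))
    have : x i ≠ 0 := hi
    positivity
  have hterm : ∀ i j, x i * (1 : Matrix (Fin p) (Fin p) ℝ) i j * x j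
      - ε * ((x i ^ 2 + x j ^ 2) / 2) ≤ x i * (M i j * x j) := by
    intro i j
    have h1 := h i j
    set d := M i j - (1 : Matrix (Fin p) (Fin p) ℝ) i j with hd
    have h2 : M i j = (1 : Matrix (Fin p) (Fin p) ℝ) i j + d := by rw [hd]; ring
    rw [h2]
    have h3 : |d * (x i * x j)| ≤ ε * ((x i ^ 2 + x j ^ 2) / 2) := by
      rw [abs_mul]
      refine mul_le_mul h1.le ?_ (abs_nonneg _) ((abs_nonneg _).trans h1.le)
      rw [abs_le]
      constructor <;> nlinarith [sq_nonneg (x i + x j), sq_nonneg (x i - x j)]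
    have h4 := (abs_le.1 h3).1
    nlinarith
  have hsum : ∑ i, ∑ j, (x i * (1 : Matrix (Fin p) (Fin p) ℝ) i j * x j
      - ε * ((x i ^ 2 + x j ^ 2) / 2)) = (1 - ε * p) * ∑ i, x i ^ 2 := by
    simp only [Finset.sum_sub_distrib, ← Finset.mul_sum, ← Finset.sum_div, Finset.sum_add_distrib,
      Finset.sum_const, Finset.card_univ, Fintype.card_fin, nsmul_eq_mul]
    have : ∑ i, ∑ j, x i * (1 : Matrix (Fin p) (Fin p) ℝ) i j * x j = ∑ i, x i ^ 2 := by
      refine Finset.sum_congr rfl fun i _ => ?_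
      simp [Matrix.one_apply, sq]
    rw [this]
    ring
  have hpos : 0 < 1 - ε * p := by
    rw [hε]
    have : (0 : ℝ) < (p : ℝ) + 1 := by positivity
    have : 1 - 1 / ((p : ℝ) + 1) * p = 1 / ((p : ℝ) + 1) := by field_simp; ring
    rw [this]
    positivity
  calc 0 < (1 - ε * p) * ∑ i, x i ^ 2 := mul_pos hpos hsq
    _ ≤ ∑ i, ∑ j, x i * (M i j * x j) := by
        rw [← hsum]
        exact Finset.sum_le_sum fun i _ => Finset.sum_le_sum fun j _ => hterm i j
    _ = star x ⬝ᵥ (M *ᵥ x) := by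
        simp [dotProduct, mulVec, Finset.mul_sum]

end GCI

namespace GCI

/-- positions: `A` first, then `C`, then the rest -/
def ps {p : ℕ} (A C : Finset (Fin p)) (v : Fin p) : ℕ :=
  v + p * (if v ∈ A then 0 else if v ∈ C then 1 else 2)

lemma ps_inj {p : ℕ} (A C : Finset (Fin p)) : Function.Injective (ps A C) := by
  intro u v h
  have h2 := congrArg (· % p) h
  simp only [ps, Nat.add_mul_mod_self_left] at h2
  rw [Nat.mod_eq_of_lt u.2, Nat.mod_eq_of_lt v.2] at h2
  exact Fin.ext h2

lemma lad_mk {p : ℕ} (A B C : Finset (Fin p)) (hAB : Disjoint A B) (hAC : Disjoint A C)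
    (hBC : Disjoint B C) (i j : Fin p) (hi : i ∈ A ∪ C) (hj : j ∈ B ∪ C) :
    Lad (ps A C) (A ∪ C) (B ∪ C) (mk i j) := by
  have key : ps A C j < ps A C i → i ∈ C ∧ j ∈ C := by
    intro hlt
    have hjA : j ∉ A := by
      rcases Finset.mem_union.1 hj with h | h
      · exact Finset.disjoint_right.1 hAB h
      · exact Finset.disjoint_right.1 hAC h
    have hi2 := i.2
    have hj2 := j.2
    simp only [ps, if_neg hjA] at hlt
    rcases Finset.mem_union.1 hi with h | h
    · simp only [if_pos h] at hlt
      split_ifs at hlt <;> omega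
    · have hiA : i ∉ A := Finset.disjoint_right.1 hAC h
      simp only [if_neg hiA, if_pos h] at hlt
      refine ⟨h, ?_⟩
      by_contra hjC
      simp only [if_neg hjC] at hlt
      omega
  have hinj := ps_inj A C
  unfold Lad lo GCI.hi
  rcases le_total i j with hij | hij
  · simp only [mk, min_eq_left hij, max_eq_right hij]
    split_ifs with h
    · exact ⟨hi, hj⟩
    · have := key (not_le.1 h)
      exact ⟨Finset.mem_union_right _ this.2, Finset.mem_union_right _ this.1⟩
  · simp only [mk, min_eq_right hij, max_eq_left hij]
    split_ifs with h
    · rcases h.lt_or_eq with h | h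
      · have := key h
        exact ⟨Finset.mem_union_right _ this.2, Finset.mem_union_right _ this.1⟩
      · have := hinj h
        subst this
        exact ⟨hi, hj⟩
    · exact ⟨hi, hj⟩

lemma lad_diag {p : ℕ} (A B C : Finset (Fin p)) (hAB : Disjoint A B) (hAC : Disjoint A C)
    (hBC : Disjoint B C) (i : Fin p) (h : Lad (ps A C) (A ∪ C) (B ∪ C) (mk i i)) : i ∈ C := by
  simp only [Lad, lo, GCI.hi, mk, min_self, max_self, le_refl, if_true, Finset.mem_union] at h
  obtain ⟨h1 | h1, h2⟩ := h
  · rcases h2 with h2 | h2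
    · exact absurd h2 (Finset.disjoint_left.1 hAB h1)
    · exact h2
  · exact h1

lemma det_zero {c p : ℕ} (u v : Fin (c + 1) → Fin p) (z : Fin c → Fin p → ℝ) :
    (Matrix.of fun a b => ∑ k, z k (u a) * z k (v b)).det = 0 := by
  set P : Matrix (Fin (c + 1)) (Fin c) ℝ := Matrix.of fun a k => z k (u a)
  set Q : Matrix (Fin c) (Fin (c + 1)) ℝ := Matrix.of fun k b => z k (v b)
  have h : (Matrix.of fun a b => ∑ k, z k (u a) * z k (v b)) = P * Q := by
    ext a b
    simp [P, Q, Matrix.mul_apply]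
  rw [h]
  by_contra hne
  have hu : IsUnit (P * Q) := (Matrix.isUnit_iff_isUnit_det _).2 (isUnit_iff_ne_zero.2 hne)
  have h1 := Matrix.rank_of_isUnit _ hu
  have h2 := (Matrix.rank_mul_le_left P Q).trans (Matrix.rank_le_card_width P)
  rw [h1] at h2
  simp at h2

open Classical in
/-- base point -/
noncomputable def z0 {p : ℕ} (C : Finset (Fin p)) : TVar C.card p → ℝ
  | Sum.inl (k, v) => if v = (C.equivFin.symm k : Fin p) then 1 else 0
  | Sum.inr e => if e.1.1 = e.1.2 then 1 else 0

lemma ptM_z0 {p : ℕ} (A B C : Finset (Fin p)) (hAB : Disjoint A B) (hAC : Disjoint A C)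
    (hBC : Disjoint B C) : ptM (ps A C) (A ∪ C) (B ∪ C) (z0 C) = 1 := by
  classical
  ext i j
  simp only [ptM, Matrix.of_apply, z0]
  by_cases hij : i = j
  · subst hij
    rw [Matrix.one_apply_eq]
    split_ifs with h h2
    · have hi := lad_diag A B C hAB hAC hBC i h
      rw [Finset.sum_eq_single (C.equivFin ⟨i, hi⟩)]
      · simp
      · intro b _ hb
        have : ¬ (i = (C.equivFin.symm b : Fin p)) := by
          intro he
          apply hb
          rw [← C.equivFin.symm_apply_eq.1 (Subtype.ext he.symm)]
        simp [this]
      · simp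
    · rfl
    · simp [mk] at h2
  · rw [Matrix.one_apply_ne hij]
    split_ifs with h h2
    · refine Finset.sum_eq_zero fun k _ => ?_
      by_cases h1 : i = (C.equivFin.symm k : Fin p)
      · have : ¬ (j = (C.equivFin.symm k : Fin p)) := fun h' => hij (h1.trans h'.symm)
        simp [this]
      · simp [h1]
    · simp only [mk] at h2
      rcases le_total i j with hle | hle
      · exact absurd (by simpa [hle] using h2) hij
      · exact absurd (by simpa [hle, eq_comm] using h2) hij
    · rfl

lemma ptM_cont {c p : ℕ} (pos : Fin p → ℕ) (Rw Cl : Finset (Fin p)) (i j : Fin p) :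
    Continuous fun z : TVar c p → ℝ => ptM pos Rw Cl z i j := by
  simp only [ptM, Matrix.of_apply]
  split_ifs <;> fun_prop

lemma vanish_sub {p : ℕ} (A B C : Finset (Fin p)) (hAB : Disjoint A B) (hAC : Disjoint A C)
    (hBC : Disjoint B C) (f : MvPolynomial (SymVar p) ℝ)
    (hf : ∀ M : Matrix (Fin p) (Fin p) ℝ, M.IsSymm → M.PosDef →
      (∀ (r s : Fin (C.card + 1) → Fin p), Function.Injective r → Function.Injective s →
        (∀ a, r a ∈ A ∪ C) → (∀ a, s a ∈ B ∪ C) → (M.submatrix r s).det = 0) →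
      eval (fun v => M v.1.1 v.1.2) f = 0) :
    aeval (sub (alw (ps A C) (A ∪ C) (B ∪ C) C.card) nu) f = 0 := by
  have hopen : ∀ᶠ z in nhds (z0 C), ∀ i j : Fin p,
      |ptM (ps A C) (A ∪ C) (B ∪ C) z i j - (1 : Matrix (Fin p) (Fin p) ℝ) i j|
        < 1 / ((p : ℝ) + 1) := by
    rw [Filter.eventually_all]
    intro i
    rw [Filter.eventually_all]
    intro j
    have hc : Continuous fun z : TVar C.card p → ℝ =>
        |ptM (ps A C) (A ∪ C) (B ∪ C) z i j - (1 : Matrix (Fin p) (Fin p) ℝ) i j| :=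
      ((ptM_cont _ _ _ i j).sub continuous_const).abs
    refine hc.continuousAt.eventually_lt continuousAt_const ?_
    rw [ptM_z0 A B C hAB hAC hBC, sub_self, abs_zero]
    positivity
  obtain ⟨δ, hδ, hball⟩ := Metric.eventually_nhds_iff_ball.1 hopen
  refine MvPolynomial.funext_set (fun x => Metric.ball (z0 C x) δ) ?_ ?_
  · intro x
    rw [Real.ball_eq_Ioo]
    exact Set.Ioo_infinite (by linarith)
  · intro z hz
    rw [map_zero, ← eval_sub]
    have hz' : z ∈ Metric.ball (z0 C) δ := by
      rw [ball_pi _ hδ]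
      exact hz
    refine hf _ (ptM_symm _ _ _ _) (posDef_near _ (ptM_symm _ _ _ _) (hball z hz')) ?_
    intro r s _ _ hr hs
    have := det_zero r s (fun k v => z (Sum.inl (k, v)))
    rw [← this]
    congr 1
    ext a b
    simp only [Matrix.submatrix_apply, ptM, Matrix.of_apply]
    rw [if_pos (lad_mk A B C hAB hAC hBC _ _ (hr a) (hs b))]

end GCI


/-- The vanishing ideal of the set of symmetric positive definite matrices all of whose
`(|C|+1) × (|C|+1)` minors of the submatrix `Σ_{(A∪C)×(B∪C)}` vanish equals the ideal
generated by those minors (viewed as polynomials in the entries `σ_{ij}`, `i ≤ j`). -/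
theorem vanishing_ideal_gaussian_condIndep
    (p : ℕ) (hp : 1 ≤ p) (A B C : Finset (Fin p))
    (hAB : Disjoint A B) (hAC : Disjoint A C) (hBC : Disjoint B C)
    (S : Set (Matrix (Fin p) (Fin p) ℝ))
    (hS : S = {M | M.IsSymm ∧ M.PosDef ∧
      ∀ (r s : Fin (C.card + 1) → Fin p), Function.Injective r → Function.Injective s →
        (∀ a, r a ∈ A ∪ C) → (∀ a, s a ∈ B ∪ C) → (M.submatrix r s).det = 0}) :
    ∀ f : MvPolynomial (SymVar p) ℝ,
      (∀ M ∈ S, MvPolynomial.eval (fun v => M v.1.1 v.1.2) f = 0) ↔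
        f ∈ Ideal.span {g : MvPolynomial (SymVar p) ℝ |
          ∃ r s : Fin (C.card + 1) → Fin p, Function.Injective r ∧ Function.Injective s ∧
            (∀ a, r a ∈ A ∪ C) ∧ (∀ a, s a ∈ B ∪ C) ∧
            g = (Matrix.of fun a b => svar (r a) (s b)).det} := by
  have easy : ∀ f ∈ GCI.minorIdeal (A ∪ C) (B ∪ C) C.card, ∀ M ∈ S,
      MvPolynomial.eval (fun v => M v.1.1 v.1.2) f = 0 := by
    intro f hf M hM
    rw [hS] at hM
    obtain ⟨hsym, -, hdet⟩ := hM
    have hle : GCI.minorIdeal (A ∪ C) (B ∪ C) C.card ≤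
        RingHom.ker (MvPolynomial.eval (fun v : SymVar p => M v.1.1 v.1.2)) := by
      refine Ideal.span_le.2 ?_
      rintro g ⟨r, s, hr, hs, hrA, hsB, rfl⟩
      rw [SetLike.mem_coe, RingHom.mem_ker, RingHom.map_det, ← hdet r s hr hs hrA hsB]
      congr 1
      ext a b
      simp only [RingHom.mapMatrix_apply, Matrix.map_apply, Matrix.of_apply, GCI.svar_eq,
        MvPolynomial.eval_X, Matrix.submatrix_apply]
      exact GCI.mk_fun (fun i j => M i j) (fun i j => hsym.apply j i) _ _
    exact hle hf
  intro f
  constructor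
  · intro hf
    obtain ⟨g, hfg, hg⟩ := GCI.reduce (GCI.ps A C) (A ∪ C) (B ∪ C) C.card f
    have hg0 : g = 0 := by
      apply GCI.indep (GCI.ps_inj A C) (A ∪ C) (B ∪ C) C.card g hg
      apply GCI.vanish_sub A B C hAB hAC hBC
      intro M h1 h2 h3
      have hM : M ∈ S := by rw [hS]; exact ⟨h1, h2, h3⟩
      have h4 := easy _ hfg M hM
      rw [map_sub, hf M hM] at h4
      linarith
    rw [hg0, sub_zero] at hfg
    exact hfg
  · exact fun hf => easy f hf
end

section
/- Fix positive integers m₁, m₂, m₃ and let S ⊆ ℝ^{[m₁]×[m₂]×[m₃]} be the set of tensors p = (p_{ijk}) with all entries nonnegative that satisfy p_{i₁j₁k}·p_{i₂j₂k} − p_{i₁j₂k}·p_{i₂j₁k} = 0 for all i₁,i₂ ∈ [m₁], j₁,j₂ ∈ [m₂], k ∈ [m₃] (equivalently, each slice (p_{ijk})_{i,j} has rank at most 1; positive multiples of joint distributions with X₁ ⊥⊥ X₂ | X₃ are exactly such tensors). Then the vanishing ideal I(S) ⊆ ℝ[p_{ijk}] equals the ideal generated by the quadratic polynomials p_{i₁j₁k}p_{i₂j₂k}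 − p_{i₁j₂k}p_{i₂j₁k}. -/
open MvPolynomial

theorem ci_prod_eq {α β γ R : Type*} [CommRing R] (g : α × β × γ → R)
    (hg : ∀ i₁ i₂ j₁ j₂ k, g (i₁, j₁, k) * g (i₂, j₂, k) = g (i₁, j₂, k) * g (i₂, j₁, k))
    (m : Multiset (α × β × γ)) : ∀ n : Multiset (α × β × γ),
    m.map (fun v => (v.1, v.2.2)) = n.map (fun v => (v.1, v.2.2)) →
    m.map (fun v => v.2) = n.map (fun v => v.2) →
    (m.map g).prod = (n.map g).prod := by
  classical
  induction m using Multiset.induction with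
  | empty =>
    intro n h _
    have : n = 0 := by simpa using h.symm
    simp [this]
  | cons a m ih =>
    intro n h1 h2
    obtain ⟨i, j, k⟩ := a
    have e1 : (i, k) ∈ n.map (fun v => (v.1, v.2.2)) := by rw [← h1]; simp
    have e2 : (j, k) ∈ n.map (fun v => v.2) := by rw [← h2]; simp
    obtain ⟨⟨i', j', k'⟩, hm, he⟩ := Multiset.mem_map.1 e1
    obtain ⟨⟨i'', j'', k''⟩, hm2, he2⟩ := Multiset.mem_map.1 e2
    simp only [Prod.mk.injEq] at he he2
    obtain ⟨rfl, rfl⟩ := he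
    obtain ⟨rfl, rfl⟩ := he2
    obtain ⟨n', rfl⟩ := Multiset.exists_cons_of_mem hm
    rcases Multiset.mem_cons.1 hm2 with hq | hq
    · simp only [Prod.mk.injEq, and_true] at hq
      obtain ⟨rfl, rfl⟩ := hq
      simp only [Multiset.map_cons, Multiset.cons_inj_right, Multiset.prod_cons] at h1 h2 ⊢
      rw [ih n' h1 h2]
    · obtain ⟨w, rfl⟩ := Multiset.exists_cons_of_mem hq
      have := ih ((i'', j', k'') ::ₘ w) (by
        simpa using h1) (by
        simp only [Multiset.map_cons] at h2 ⊢
        rw [Multiset.cons_swap] at h2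
        simpa using h2)
      simp only [Multiset.map_cons, Multiset.prod_cons] at this ⊢
      rw [this, ← mul_assoc, ← mul_assoc, hg]

/-- The vanishing ideal of the set of nonnegative tensors whose slices
`(p_{ijk})_{i,j}` all have rank at most one (i.e. satisfy the `2×2` slice quadrics)
equals the ideal generated by the quadrics
`p_{i₁j₁k} p_{i₂j₂k} − p_{i₁j₂k} p_{i₂j₁k}`. -/
theorem vanishing_ideal_discrete_condIndep
    (m₁ m₂ m₃ : ℕ) (S : Set (Fin m₁ → Fin m₂ → Fin m₃ → ℝ))
    (hS : S = {q | (∀ i j k, 0 ≤ q i j k) ∧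
      ∀ (i₁ i₂ : Fin m₁) (j₁ j₂ : Fin m₂) (k : Fin m₃),
        q i₁ j₁ k * q i₂ j₂ k - q i₁ j₂ k * q i₂ j₁ k = 0}) :
    ∀ f : MvPolynomial (Fin m₁ × Fin m₂ × Fin m₃) ℝ,
      (∀ q ∈ S, MvPolynomial.eval (fun v => q v.1 v.2.1 v.2.2) f = 0) ↔
        f ∈ Ideal.span {g : MvPolynomial (Fin m₁ × Fin m₂ × Fin m₃) ℝ |
          ∃ (i₁ i₂ : Fin m₁) (j₁ j₂ : Fin m₂) (k : Fin m₃),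
            g = X (i₁, j₁, k) * X (i₂, j₂, k) - X (i₁, j₂, k) * X (i₂, j₁, k)} := by
  classical
  intro f
  set I := Ideal.span {g : MvPolynomial (Fin m₁ × Fin m₂ × Fin m₃) ℝ |
          ∃ (i₁ i₂ : Fin m₁) (j₁ j₂ : Fin m₂) (k : Fin m₃),
            g = X (i₁, j₁, k) * X (i₂, j₂, k) - X (i₁, j₂, k) * X (i₂, j₁, k)} with hI
  constructor
  swap
  · intro hf q hq
    rw [hS] at hq
    have : I ≤ RingHom.ker (MvPolynomial.eval (fun v : Fin m₁ × Fin m₂ × Fin m₃ => q v.1 v.2.1 v.2.2)) := by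
      rw [hI, Ideal.span_le]
      rintro g ⟨i₁, i₂, j₁, j₂, k, rfl⟩
      simpa using hq.2 i₁ i₂ j₁ j₂ k
    exact this hf
  intro hf
  let φ : MvPolynomial (Fin m₁ × Fin m₂ × Fin m₃) ℝ →ₐ[ℝ]
      MvPolynomial ((Fin m₁ × Fin m₃) ⊕ (Fin m₂ × Fin m₃)) ℝ :=
    aeval (fun v => X (Sum.inl (v.1, v.2.2)) * X (Sum.inr v.2))
  have hφ : φ f = 0 := by
    apply MvPolynomial.funext_set (fun _ => Set.Ici (0:ℝ)) (fun _ => Set.Ici_infinite 0)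
    intro x hx
    have hx : ∀ t, 0 ≤ x t := fun t => hx t (Set.mem_univ t)
    have h := hf (fun i j k => x (Sum.inl (i, k)) * x (Sum.inr (j, k))) (by
      rw [hS]
      exact ⟨fun i j k => mul_nonneg (hx _) (hx _), fun _ _ _ _ _ => by ring⟩)
    rw [map_zero, ← h]
    change ((MvPolynomial.aeval x).comp φ) f = MvPolynomial.aeval _ f
    congr 1
    ext v
    simp [φ]
  let A : ((Fin m₁ × Fin m₂ × Fin m₃) →₀ ℕ) → (((Fin m₁ × Fin m₃) ⊕ (Fin m₂ × Fin m₃)) →₀ ℕ) :=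
    fun u => (u.mapDomain (fun v => (v.1, v.2.2))).mapDomain Sum.inl +
      (u.mapDomain (fun v => v.2)).mapDomain Sum.inr
  have hA : ∀ u, φ (monomial u 1) = monomial (A u) 1 := by
    intro u
    induction u using Finsupp.induction_linear with
    | zero => simp [A]
    | add u v hu hv =>
      have h1 : A (u + v) = A u + A v := by
        simp only [A, Finsupp.mapDomain_add]; abel
      have h2 : ∀ {σ : Type} (u v : σ →₀ ℕ),
        monomial (u + v) (1:ℝ) = monomial u 1 * monomial v 1 := by intros; simp
      rw [h1, h2, h2, map_mul, hu, hv]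
    | single v n =>
      simp only [φ, aeval_monomial]
      simp [A, Finsupp.mapDomain_single, mul_pow, X_pow_eq_monomial]
  let mk := Ideal.Quotient.mkₐ ℝ I
  have hfac : Function.FactorsThrough (fun u => mk (monomial u 1)) A := by
    intro u v huv
    have e1 : u.mapDomain (fun v => (v.1, v.2.2)) = v.mapDomain (fun v => (v.1, v.2.2)) := by
      ext x
      have := DFunLike.congr_fun huv (Sum.inl x)
      simpa [A, Finsupp.mapDomain_apply Sum.inl_injective, Finsupp.mapDomain_of_notMem_range] using this
    have e2 : u.mapDomain (fun v => v.2) = v.mapDomain (fun v => v.2) := by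
      ext x
      have := DFunLike.congr_fun huv (Sum.inr x)
      simpa [A, Finsupp.mapDomain_apply Sum.inr_injective, Finsupp.mapDomain_of_notMem_range] using this
    have hp : ∀ u, mk (monomial u 1) =
        ((Finsupp.toMultiset u).map (fun v => mk (X v))).prod := by
      intro u
      rw [Finsupp.toMultiset_map, Finsupp.prod_toMultiset, MvPolynomial.monomial_eq]
      rw [Finsupp.prod_mapDomain_index (by simp) (by intros; rw [pow_add])]
      simp only [Finsupp.prod, C_1, one_mul, map_prod, map_pow]
    simp only [hp]
    apply ci_prod_eq
    · intro i₁ i₂ j₁ j₂ k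
      rw [← map_mul, ← map_mul]
      refine (Ideal.Quotient.eq).2 (Ideal.subset_span ⟨i₁, i₂, j₁, j₂, k, rfl⟩)
    · rw [Finsupp.toMultiset_map, Finsupp.toMultiset_map, e1]
    · rw [Finsupp.toMultiset_map, Finsupp.toMultiset_map, e2]
  let ψ := (basisMonomials ((Fin m₁ × Fin m₃) ⊕ (Fin m₂ × Fin m₃)) ℝ).constr ℝ
    (Function.extend A (fun u => mk (monomial u 1)) 0)
  have hψ : ψ ∘ₗ φ.toLinearMap = mk.toLinearMap := by
    apply (basisMonomials (Fin m₁ × Fin m₂ × Fin m₃) ℝ).ext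
    intro u
    simp only [coe_basisMonomials, LinearMap.comp_apply, AlgHom.toLinearMap_apply, hA]
    rw [← hfac.extend_apply 0 u]
    have := (basisMonomials ((Fin m₁ × Fin m₃) ⊕ (Fin m₂ × Fin m₃)) ℝ).constr_basis ℝ
      (Function.extend A (fun u => mk (monomial u 1)) 0) (A u)
    simpa only [coe_basisMonomials] using this
  have h := LinearMap.congr_fun hψ f
  simp only [LinearMap.comp_apply, AlgHom.toLinearMap_apply, hφ, map_zero] at h
  exact Ideal.Quotient.eq_zero_iff_mem.1 h.symm
end

section
/- Let X₁ and X₂ be random variables on a common probability space taking values in finite sets, and let X₃ be a random variable taking values in a two-element set. Then the conjunction [X₁ ⊥⊥ X₂ and X₁ ⊥⊥ X₂ | X₃] holds if and only if [X₁ ⊥⊥ (X₂,X₃) or X₂ ⊥⊥ (X₁,X₃)] holds. -/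
open MeasureTheory ProbabilityTheory

lemma condExp_fiber {γ Ω : Type} [MeasurableSpace γ] [DiscreteMeasurableSpace γ]
    [MeasurableSpace Ω] (P : Measure Ω) [IsProbabilityMeasure P]
    (Z : Ω → γ) (hZ : Measurable Z) (s : Set Ω) (hs : MeasurableSet s) :
    ∃ g : γ → ℝ, (P⟦s | MeasurableSpace.comap Z inferInstance⟧) = g ∘ Z ∧
      ∀ c, g c * P.real (Z ⁻¹' {c}) = P.real (s ∩ Z ⁻¹' {c}) := by
  obtain ⟨g, -, hg⟩ := (stronglyMeasurable_condExp (μ := P)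
    (m := MeasurableSpace.comap Z inferInstance)
    (f := s.indicator fun _ => (1 : ℝ))).exists_eq_measurable_comp
  refine ⟨g, hg, fun c => ?_⟩
  have hc : MeasurableSet (Z ⁻¹' {c}) := hZ (MeasurableSet.of_discrete)
  have h := setIntegral_condExp (μ := P) hZ.comap_le
    (f := s.indicator fun _ => (1 : ℝ)) ((integrable_const 1).indicator hs)
    (s := Z ⁻¹' {c}) ⟨{c}, MeasurableSet.of_discrete, rfl⟩
  rw [hg, setIntegral_congr_fun (g := fun _ => g c) hc
    (fun ω hω => by
      have : Z ω = c := hω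
      simp [this])] at h
  rw [setIntegral_const, integral_indicator_const _ hs, measureReal_restrict_apply hs] at h
  simp only [smul_eq_mul, mul_one] at h
  linarith

lemma condIndep_iff_fiber {α β γ Ω : Type} [Finite γ]
    [MeasurableSpace α] [DiscreteMeasurableSpace α]
    [MeasurableSpace β] [DiscreteMeasurableSpace β]
    [MeasurableSpace γ] [DiscreteMeasurableSpace γ]
    [MeasurableSpace Ω] [StandardBorelSpace Ω] (P : Measure Ω) [IsProbabilityMeasure P]
    (X : Ω → α) (Y : Ω → β) (Z : Ω → γ)
    (hX : Measurable X) (hY : Measurable Y) (hZ : Measurable Z) :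
    CondIndepFun (MeasurableSpace.comap Z inferInstance) hZ.comap_le X Y P ↔
    ∀ (A : Set α) (B : Set β) (c : γ),
      P.real (X ⁻¹' A ∩ Y ⁻¹' B ∩ Z ⁻¹' {c}) * P.real (Z ⁻¹' {c}) =
        P.real (X ⁻¹' A ∩ Z ⁻¹' {c}) * P.real (Y ⁻¹' B ∩ Z ⁻¹' {c}) := by
  rw [condIndepFun_iff_condExp_inter_preimage_eq_mul hX hY]
  have mX : ∀ A, MeasurableSet (X ⁻¹' A) := fun A => hX MeasurableSet.of_discrete
  have mY : ∀ A, MeasurableSet (Y ⁻¹' A) := fun A => hY MeasurableSet.of_discrete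
  constructor
  · intro h A B c
    have h := h A B MeasurableSet.of_discrete MeasurableSet.of_discrete
    obtain ⟨f, hf, hf'⟩ := condExp_fiber P Z hZ _ ((mX A).inter (mY B))
    obtain ⟨g, hg, hg'⟩ := condExp_fiber P Z hZ _ (mX A)
    obtain ⟨k, hk, hk'⟩ := condExp_fiber P Z hZ _ (mY B)
    rw [hf, hg, hk] at h
    rw [← hf', ← hg', ← hk']
    by_cases h0 : P (Z ⁻¹' {c}) = 0
    · simp [measureReal_def, h0]
    · have : ∃ ω, Z ω = c ∧ f (Z ω) = g (Z ω) * k (Z ω) := by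
        by_contra! hne
        apply h0
        refine measure_mono_null ?_ h
        intro ω hω
        exact hne ω hω
      obtain ⟨ω, rfl, hω⟩ := this
      rw [hω]; ring
  · intro h A B _ _
    have h := h A B
    obtain ⟨f, hf, hf'⟩ := condExp_fiber P Z hZ _ ((mX A).inter (mY B))
    obtain ⟨g, hg, hg'⟩ := condExp_fiber P Z hZ _ (mX A)
    obtain ⟨k, hk, hk'⟩ := condExp_fiber P Z hZ _ (mY B)
    rw [hf, hg, hk]
    have hae : ∀ᵐ ω ∂P, ∀ c, P (Z ⁻¹' {c}) = 0 → Z ω ≠ c := by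
      rw [ae_all_iff]
      intro c
      by_cases h0 : P (Z ⁻¹' {c}) = 0
      · have := measure_eq_zero_iff_ae_notMem.1 h0
        filter_upwards [this] with ω hω _ h using hω h
      · simp [h0]
    filter_upwards [hae] with ω hω
    have h0 : P.real (Z ⁻¹' {Z ω}) ≠ 0 := by
      intro h0
      refine hω (Z ω) ?_ rfl
      exact (measureReal_eq_zero_iff (measure_ne_top _ _)).1 h0
    have h := h (Z ω)
    rw [← hf', ← hg', ← hk'] at h
    simp only [Function.comp]
    apply mul_right_cancel₀ h0
    apply mul_right_cancel₀ h0
    linarith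

lemma indep_iff_real {α β Ω : Type}
    [MeasurableSpace α] [DiscreteMeasurableSpace α]
    [MeasurableSpace β] [DiscreteMeasurableSpace β]
    [MeasurableSpace Ω] (P : Measure Ω) [IsProbabilityMeasure P] (X : Ω → α) (Y : Ω → β) :
    IndepFun X Y P ↔ ∀ (A : Set α) (B : Set β),
      P.real (X ⁻¹' A ∩ Y ⁻¹' B) = P.real (X ⁻¹' A) * P.real (Y ⁻¹' B) := by
  rw [indepFun_iff_measure_inter_preimage_eq_mul]
  constructor
  · intro h A B
    simp [measureReal_def, h A B MeasurableSet.of_discrete MeasurableSet.of_discrete]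
  · intro h A B _ _
    have := h A B
    rw [measureReal_def, measureReal_def, measureReal_def, ← ENNReal.toReal_mul] at this
    exact (ENNReal.toReal_eq_toReal_iff' (measure_ne_top _ _)
      (ENNReal.mul_ne_top (measure_ne_top _ _) (measure_ne_top _ _))).1 this

lemma split_fiber {γ Ω : Type} [MeasurableSpace γ] [DiscreteMeasurableSpace γ]
    [MeasurableSpace Ω] (P : Measure Ω) [IsProbabilityMeasure P]
    (Z : Ω → γ) (hZ : Measurable Z) (c d : γ) (hcd : c ≠ d) (hu : ∀ e, e = c ∨ e = d)
    (s : Set Ω) :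
    P.real s = P.real (s ∩ Z ⁻¹' {c}) + P.real (s ∩ Z ⁻¹' {d}) := by
  rw [← measureReal_inter_add_sdiff (s := s) (t := Z ⁻¹' {c}) (hZ MeasurableSet.of_discrete)]
  congr 2
  ext ω
  have := hu (Z ω)
  simp only [Set.mem_sdiff, Set.mem_inter_iff, Set.mem_preimage, Set.mem_singleton_iff]
  grind

lemma indep_pair_iff {α β γ Ω : Type} [Countable β] [Countable γ]
    [MeasurableSpace α] [DiscreteMeasurableSpace α]
    [MeasurableSpace β] [DiscreteMeasurableSpace β]
    [MeasurableSpace γ] [DiscreteMeasurableSpace γ]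
    [MeasurableSpace Ω] (P : Measure Ω) [IsProbabilityMeasure P]
    (X : Ω → α) (Y : Ω → β) (Z : Ω → γ) (hZ : Measurable Z)
    (c d : γ) (hcd : c ≠ d) (hu : ∀ e, e = c ∨ e = d) :
    IndepFun X (fun ω => (Y ω, Z ω)) P ↔ ∀ (A : Set α) (B : Set β) (c : γ),
      P.real (X ⁻¹' A ∩ Y ⁻¹' B ∩ Z ⁻¹' {c}) =
        P.real (X ⁻¹' A) * P.real (Y ⁻¹' B ∩ Z ⁻¹' {c}) := by
  rw [indep_iff_real]
  constructor
  · intro h A B c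
    have := h A (B ×ˢ {c})
    rwa [Set.mk_preimage_prod, ← Set.inter_assoc] at this
  · intro h A D
    have key : ∀ e, (fun ω => (Y ω, Z ω)) ⁻¹' D ∩ Z ⁻¹' {e}
        = Y ⁻¹' {b | (b, e) ∈ D} ∩ Z ⁻¹' {e} := by
      intro e
      ext ω
      simp only [Set.mem_inter_iff, Set.mem_preimage, Set.mem_singleton_iff, Set.mem_ofPred_eq]
      constructor <;> (rintro ⟨h, rfl⟩; exact ⟨h, rfl⟩)
    rw [split_fiber P Z hZ c d hcd hu (_ ∩ _), split_fiber P Z hZ c d hcd hu (_ ⁻¹' D),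
      Set.inter_assoc, Set.inter_assoc, key, key, ← Set.inter_assoc, ← Set.inter_assoc, h, h]
    ring

/-- Elementary algebra used in the forward direction. -/
lemma forward_aux {u0 u1 A0 A1 : ℝ} (hu : u0 + u1 = 1) (h : A0 * u1 - A1 * u0 = 0) :
    A0 = (A0 + A1) * u0 ∧ A1 = (A0 + A1) * u1 := by
  constructor
  · linear_combination h - A0 * hu
  · linear_combination -h - A1 * hu

/-- For discrete random variables `X₁, X₂` with values in finite sets and `X₃` with values
in a two-element set: `[X₁ ⊥⊥ X₂ and X₁ ⊥⊥ X₂ | X₃]` holds if and only if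
`[X₁ ⊥⊥ (X₂,X₃) or X₂ ⊥⊥ (X₁,X₃)]` holds. -/
theorem marginal_and_conditional_indep_iff_binary
    {α β γ Ω : Type} [Fintype α] [Fintype β] [Fintype γ]
    [MeasurableSpace α] [DiscreteMeasurableSpace α]
    [MeasurableSpace β] [DiscreteMeasurableSpace β]
    [MeasurableSpace γ] [DiscreteMeasurableSpace γ]
    (hγ : Fintype.card γ = 2)
    [MeasurableSpace Ω] [StandardBorelSpace Ω]
    (P : Measure Ω) [IsProbabilityMeasure P]
    (X₁ : Ω → α) (X₂ : Ω → β) (X₃ : Ω → γ)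
    (h₁ : Measurable X₁) (h₂ : Measurable X₂) (h₃ : Measurable X₃) :
    (IndepFun X₁ X₂ P ∧
      CondIndepFun (MeasurableSpace.comap X₃ inferInstance) h₃.comap_le X₁ X₂ P) ↔
    (IndepFun X₁ (fun ω => (X₂ ω, X₃ ω)) P ∨ IndepFun X₂ (fun ω => (X₁ ω, X₃ ω)) P) := by
  classical
  obtain ⟨c, d, hcd, huniv⟩ := Finset.card_eq_two.1 (Finset.card_univ.trans hγ)
  have hu : ∀ e, e = c ∨ e = d := fun e => by
    have := Finset.mem_univ e
    rw [huniv] at this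
    simpa using this
  rw [condIndep_iff_fiber P X₁ X₂ X₃ h₁ h₂ h₃, indep_iff_real,
    indep_pair_iff P X₁ X₂ X₃ h₃ c d hcd hu, indep_pair_iff P X₂ X₁ X₃ h₃ c d hcd hu]
  have sp := split_fiber P X₃ h₃ c d hcd hu
  have hsum : P.real (X₃ ⁻¹' {c}) + P.real (X₃ ⁻¹' {d}) = 1 := by
    have := sp Set.univ
    simpa using this.symm
  have hz : ∀ (s : Set Ω) (e : γ), P.real (X₃ ⁻¹' {e}) = 0 → P.real (s ∩ X₃ ⁻¹' {e}) = 0 :=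
    fun s e h => le_antisymm (h ▸ measureReal_mono Set.inter_subset_right) measureReal_nonneg
  constructor
  · rintro ⟨hi, hc⟩
    have key : ∀ (A : Set α) (B : Set β),
        (P.real (X₁ ⁻¹' A ∩ X₃ ⁻¹' {c}) * P.real (X₃ ⁻¹' {d})
          - P.real (X₁ ⁻¹' A ∩ X₃ ⁻¹' {d}) * P.real (X₃ ⁻¹' {c})) *
        (P.real (X₂ ⁻¹' B ∩ X₃ ⁻¹' {c}) * P.real (X₃ ⁻¹' {d})
          - P.real (X₂ ⁻¹' B ∩ X₃ ⁻¹' {d}) * P.real (X₃ ⁻¹' {c})) = 0 := by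
      intro A B
      have e1 := hi A B
      rw [sp (_ ∩ _), sp (X₁ ⁻¹' A), sp (X₂ ⁻¹' B)] at e1
      have e2 := hc A B c
      have e3 := hc A B d
      generalize P.real (X₁ ⁻¹' A ∩ X₂ ⁻¹' B ∩ X₃ ⁻¹' {c}) = x at *
      generalize P.real (X₁ ⁻¹' A ∩ X₂ ⁻¹' B ∩ X₃ ⁻¹' {d}) = y at *
      generalize P.real (X₁ ⁻¹' A ∩ X₃ ⁻¹' {c}) = a at *
      generalize P.real (X₁ ⁻¹' A ∩ X₃ ⁻¹' {d}) = a' at *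
      generalize P.real (X₂ ⁻¹' B ∩ X₃ ⁻¹' {c}) = b at *
      generalize P.real (X₂ ⁻¹' B ∩ X₃ ⁻¹' {d}) = b' at *
      generalize P.real (X₃ ⁻¹' {c}) = u at *
      generalize P.real (X₃ ⁻¹' {d}) = v at *
      obtain rfl : v = 1 - u := by linarith
      linear_combination u * (1 - u) * e1 - (1 - u) * e2 - u * e3
    by_cases hA : ∀ A : Set α, P.real (X₁ ⁻¹' A ∩ X₃ ⁻¹' {c}) * P.real (X₃ ⁻¹' {d})
          - P.real (X₁ ⁻¹' A ∩ X₃ ⁻¹' {d}) * P.real (X₃ ⁻¹' {c}) = 0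
    · left
      intro A B e
      have h1 : P.real (X₁ ⁻¹' A ∩ X₃ ⁻¹' {e}) = P.real (X₁ ⁻¹' A) * P.real (X₃ ⁻¹' {e}) := by
        have := forward_aux hsum (hA A)
        rw [← sp] at this
        rcases hu e with rfl | rfl
        exacts [this.1, this.2]
      by_cases h0 : P.real (X₃ ⁻¹' {e}) = 0
      · rw [hz _ _ h0, hz _ _ h0, mul_zero]
      · apply mul_right_cancel₀ h0
        rw [hc, h1]; ring
    · right
      push Not at hA
      obtain ⟨A₀, hA₀⟩ := hA
      intro B A e
      have h1 : P.real (X₂ ⁻¹' B ∩ X₃ ⁻¹' {e}) = P.real (X₂ ⁻¹' B) * P.real (X₃ ⁻¹' {e}) := by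
        have := forward_aux hsum ((mul_eq_zero.1 (key A₀ B)).resolve_left hA₀)
        rw [← sp] at this
        rcases hu e with rfl | rfl
        exacts [this.1, this.2]
      rw [Set.inter_comm (X₂ ⁻¹' B)]
      by_cases h0 : P.real (X₃ ⁻¹' {e}) = 0
      · rw [hz _ _ h0, hz _ _ h0, mul_zero]
      · apply mul_right_cancel₀ h0
        rw [hc, h1]; ring
  · rintro (h | h)
    · refine ⟨fun A B => ?_, fun A B e => ?_⟩
      · rw [sp (_ ∩ _), h, h, sp (X₂ ⁻¹' B)]; ring
      · have := h A Set.univ e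
        simp only [Set.preimage_univ, Set.inter_univ, Set.univ_inter] at this
        rw [h, this]; ring
    · refine ⟨fun A B => ?_, fun A B e => ?_⟩
      · rw [Set.inter_comm, sp (_ ∩ _), h, h, sp (X₁ ⁻¹' A)]; ring
      · have := h B Set.univ e
        simp only [Set.preimage_univ, Set.inter_univ, Set.univ_inter] at this
        rw [Set.inter_comm (X₁ ⁻¹' A) (X₂ ⁻¹' B), h, this]; ring
end

section
/- Let (X₁,X₂,X₃) be a random vector with trivariate normal distribution N₃(μ,Σ), Σ positive definite. Then the conjunction [X₁ ⊥⊥ X₂ and X₁ ⊥⊥ X₂ | X₃] holds if and only if [X₁ ⊥⊥ (X₂,X₃) or X₂ ⊥⊥ (X₁,X₃)] holds. -/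
open MeasureTheory ProbabilityTheory Matrix

theorem aux_pi_density (n : ℕ) :
    (Measure.pi fun _ : Fin n => gaussianReal 0 1) =
      volume.withDensity (fun x : Fin n → ℝ => ENNReal.ofReal (∏ i, gaussianPDFReal 0 1 (x i))) := by
  refine Measure.pi_eq fun s hs => ?_
  have hb : MeasurableSet (Set.univ.pi s) := MeasurableSet.univ_pi hs
  rw [withDensity_apply _ hb, ← lintegral_indicator hb]
  have h1 : ∀ x : Fin n → ℝ, (Set.univ.pi s).indicator
      (fun x => ENNReal.ofReal (∏ i, gaussianPDFReal 0 1 (x i))) x =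
      ENNReal.ofReal (∏ i, (s i).indicator (gaussianPDFReal 0 1) (x i)) := by
    intro x
    by_cases hx : x ∈ Set.univ.pi s
    · rw [Set.indicator_of_mem hx]
      congr 1
      refine Finset.prod_congr rfl fun i _ => ?_
      rw [Set.indicator_of_mem (hx i trivial)]
    · rw [Set.indicator_of_notMem hx]
      simp only [Set.mem_pi, Set.mem_univ, true_imp_iff, not_forall] at hx
      obtain ⟨i, hi⟩ := hx
      rw [Finset.prod_eq_zero (Finset.mem_univ i) (Set.indicator_of_notMem hi _)]
      simp
  simp_rw [h1]
  have hint : ∀ i, Integrable ((s i).indicator (gaussianPDFReal 0 1)) := fun i =>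
    (integrable_gaussianPDFReal 0 1).indicator (hs i)
  have hnn : ∀ i x, 0 ≤ (s i).indicator (gaussianPDFReal 0 1) x := fun i x =>
    Set.indicator_nonneg (fun _ _ => gaussianPDFReal_nonneg _ _ _) _
  rw [← ofReal_integral_eq_lintegral_ofReal (μ := (volume : Measure (Fin n → ℝ)))
    (Integrable.fintype_prod hint)
    (.of_forall fun x => Finset.prod_nonneg fun i _ => hnn i _),
    integral_fintype_prod_volume_eq_prod (fun i => (s i).indicator (gaussianPDFReal 0 1)),
    ENNReal.ofReal_prod_of_nonneg (fun i _ => integral_nonneg (hnn i))]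
  refine Finset.prod_congr rfl fun i _ => ?_
  rw [integral_indicator (hs i), gaussianReal_apply_eq_integral _ one_ne_zero]

theorem aux_map_withDensity {α β : Type*} [MeasurableSpace α] [MeasurableSpace β] (ν : Measure α)
    (T : α → β) (hT : Measurable T) (F : β → ENNReal) (hF : Measurable F) :
    (ν.withDensity (fun x => F (T x))).map T = (ν.map T).withDensity F := by
  ext s hs
  rw [Measure.map_apply hT hs, withDensity_apply _ (hT hs), withDensity_apply _ hs,
    setLIntegral_map hs hF hT]

open scoped MatrixOrder in
theorem aux_fact {n : ℕ} (Q : Matrix (Fin n) (Fin n) ℝ) (hQ : Q.PosDef) :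
    ∃ B : Matrix (Fin n) (Fin n) ℝ, B.det ≠ 0 ∧ Q = Bᵀ * B := by
  obtain ⟨B, hB⟩ := CStarAlgebra.nonneg_iff_eq_star_mul_self.mp hQ.posSemidef.nonneg
  have h : Q = Bᵀ * B := by
    rw [hB, star_eq_conjTranspose, conjTranspose_eq_transpose_of_trivial]
  refine ⟨B, fun h0 => ?_, h⟩
  have := hQ.det_pos
  rw [h, det_mul, h0] at this
  simp at this

theorem aux_gauss (p : ℕ) (μ : Fin p → ℝ) (S : Matrix (Fin p) (Fin p) ℝ) (hS : S.PosDef)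
    (hp : IsProbabilityMeasure (mvNormal p μ S)) : IsGaussian (mvNormal p μ S) := by
  obtain ⟨B, hB, hQ⟩ := aux_fact S⁻¹ hS.inv
  set T : (Fin p → ℝ) → (Fin p → ℝ) := fun x => toLin' B (x - μ) with hTdef
  have hLm : Measurable (toLin' B) := (LinearMap.continuous_of_finiteDimensional _).measurable
  have hT : Measurable T := hLm.comp (by fun_prop)
  set c : ℝ := (Real.sqrt (2 * Real.pi)) ^ p / Real.sqrt ((2 * Real.pi) ^ p * S.det) with hc
  have hc0 : 0 ≤ c := by positivity
  have hquad : ∀ x, ∑ i, ∑ j, (x i - μ i) * S⁻¹ i j * (x j - μ j) = ∑ i, (T x i) ^ 2 := by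
    intro x
    have h1 : ∑ i, ∑ j, (x i - μ i) * S⁻¹ i j * (x j - μ j)
        = (x - μ) ⬝ᵥ (S⁻¹ *ᵥ (x - μ)) := by
      simp [dotProduct, mulVec, Finset.mul_sum, mul_assoc]
    rw [h1, hQ, ← mulVec_mulVec, mulVec_transpose, ← dotProduct_comm, ← dotProduct_mulVec]
    simp [dotProduct, T, sq]
  have hdens : ∀ x, ENNReal.ofReal (Real.exp (-(∑ i, ∑ j, (x i - μ i) * S⁻¹ i j * (x j - μ j)) / 2) /
      Real.sqrt ((2 * Real.pi) ^ p * S.det)) =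
      (ENNReal.ofReal c • fun y : Fin p → ℝ => ENNReal.ofReal (∏ i, gaussianPDFReal 0 1 (y i))) (T x) := by
    intro x
    rw [hquad, Pi.smul_apply, smul_eq_mul, ← ENNReal.ofReal_mul hc0]
    congr 1
    simp only [gaussianPDFReal, Finset.prod_mul_distrib, ← Real.exp_sum, Finset.prod_const,
      Finset.card_univ, Fintype.card_fin, NNReal.coe_one, mul_one, sub_zero, hc]
    rw [← Finset.sum_div, Finset.sum_neg_distrib]
    have : Real.sqrt (2 * Real.pi) ^ p ≠ 0 := by positivity
    rw [inv_pow]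
    field_simp
  have hvol : Measure.map T volume = ENNReal.ofReal (abs (det B)⁻¹) • volume := by
    have : T = toLin' B ∘ (fun x => x - μ) := rfl
    rw [this, ← Measure.map_map hLm (by fun_prop), map_sub_right_eq_self,
      Real.map_matrix_volume_pi_eq_smul_volume_pi hB]
  have hmeasF : Measurable (fun y : Fin p → ℝ => ENNReal.ofReal (∏ i, gaussianPDFReal 0 1 (y i))) := by
    fun_prop
  obtain ⟨k, hk⟩ : ∃ k : ENNReal, (mvNormal p μ S).map T =
      k • Measure.pi fun _ : Fin p => gaussianReal 0 1 := by
    refine ⟨ENNReal.ofReal c * ENNReal.ofReal (abs (det B)⁻¹), ?_⟩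
    rw [mvNormal]
    simp_rw [hdens]
    rw [aux_map_withDensity _ _ hT _ (hmeasF.const_smul _), hvol, withDensity_smul_measure,
      withDensity_smul _ hmeasF, ← aux_pi_density, smul_smul, mul_comm]
  have hk1 : k = 1 := by
    have h1 : ((mvNormal p μ S).map T) Set.univ = 1 := by
      rw [Measure.map_apply hT .univ]; simp
    rw [hk] at h1
    simpa using h1
  rw [hk1, one_smul] at hk
  have hpi : IsGaussian (Measure.pi fun _ : Fin p => gaussianReal 0 1) := by
    have hX1 : ∀ i : Fin p, HasGaussianLaw (fun x : Fin p → ℝ => x i)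
        (Measure.pi fun _ : Fin p => gaussianReal 0 1) := by
      intro i
      have := (measurePreserving_eval (fun _ : Fin p => gaussianReal 0 1) i).map_eq
      constructor
      change IsGaussian (Measure.map (Function.eval (β := fun _ : Fin p => ℝ) i) _)
      rw [this]; infer_instance
    have hX2 : iIndepFun (fun (i : Fin p) (x : Fin p → ℝ) => x i)
        (Measure.pi fun _ : Fin p => gaussianReal 0 1) :=
      iIndepFun_pi (μ := fun _ : Fin p => gaussianReal 0 1)
        (X := fun (_ : Fin p) (x : ℝ) => x) (fun i => aemeasurable_id)
    have h2 := (iIndepFun.hasGaussianLaw (E := fun _ : Fin p => ℝ) hX1 hX2).isGaussian_map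
    simpa using h2
  rw [← hk] at hpi
  let L : (Fin p → ℝ) →L[ℝ] (Fin p → ℝ) := LinearMap.toContinuousLinearMap (toLin' B⁻¹)
  have hfin : (((mvNormal p μ S).map T).map L).map (fun x => x + μ) = mvNormal p μ S := by
    rw [Measure.map_map L.continuous.measurable hT, Measure.map_map (by fun_prop)
      (L.continuous.measurable.comp hT)]
    convert Measure.map_id
    ext x i
    simp [L, T, nonsing_inv_mul _ (isUnit_iff_ne_zero.2 hB)]
  rw [← hfin]
  infer_instance

theorem aux_condIndep {Ω : Type} [mΩ : MeasurableSpace Ω] [StandardBorelSpace Ω]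
    (P : Measure Ω) [IsProbabilityMeasure P] (U V W : Ω → ℝ)
    (hU : Measurable U) (hV : Measurable V) (hW : Measurable W)
    (h : IndepFun U (fun ω => (V ω, W ω)) P) :
    CondIndepFun (MeasurableSpace.comap W inferInstance) hW.comap_le U V P := by
  rw [condIndepFun_iff_condExp_inter_preimage_eq_mul hU hV]
  intro s t hs ht
  have hUW : IndepFun U W P := h.comp measurable_id measurable_snd
  have h1 : P⟦U ⁻¹' s | MeasurableSpace.comap W inferInstance⟧ =ᵐ[P]
      fun _ => ∫ ω, (U ⁻¹' s).indicator (fun _ => (1:ℝ)) ω ∂P := by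
    refine condExp_indep_eq hU.comap_le hW.comap_le ?_ hUW
    exact stronglyMeasurable_const.indicator ⟨s, hs, rfl⟩
  have hms := hU hs
  have hmt := hV ht
  have hii : ∀ A, MeasurableSet A → Integrable (A.indicator (fun _ => (1:ℝ))) P := fun A hA =>
    (integrable_const _).indicator hA
  symm
  refine (ae_eq_condExp_of_forall_setIntegral_eq hW.comap_le
    (g := fun ω => (P.real (U ⁻¹' s)) *
      (P⟦V ⁻¹' t | MeasurableSpace.comap W inferInstance⟧) ω)
    (hii _ (hms.inter hmt)) ?_ ?_ ?_).symm.trans ?_ |>.symm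
  · intro c hc _
    exact (integrable_condExp.const_mul _).integrableOn
  · rintro c ⟨c', hc', rfl⟩ _
    have hmc := hW hc'
    rw [integral_const_mul, setIntegral_condExp hW.comap_le (hii _ hmt) ⟨c', hc', rfl⟩,
      setIntegral_indicator hmt, setIntegral_indicator (hms.inter hmt)]
    simp only [integral_const, smul_eq_mul, mul_one, measureReal_restrict_apply_univ]
    have := h.measure_inter_preimage_eq_mul s (t ×ˢ c') hs (ht.prod hc')
    have h2 : (fun ω => (V ω, W ω)) ⁻¹' (t ×ˢ c') = W ⁻¹' c' ∩ V ⁻¹' t := by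
      ext; simp [and_comm]
    rw [h2] at this
    rw [Measure.real, Measure.real, Measure.real, ← ENNReal.toReal_mul, ← this]
    congr 2
    ext; simp; tauto
  · exact (stronglyMeasurable_condExp.const_mul _).aestronglyMeasurable
  · filter_upwards [h1] with ω hω
    rw [hω, integral_indicator hms]
    simp

theorem aux_prod {Ω : Type} (m : MeasurableSpace Ω) [mΩ : MeasurableSpace Ω] [StandardBorelSpace Ω]
    (P : Measure Ω) [IsProbabilityMeasure P] (U V : Ω → ℝ) (hm : m ≤ mΩ)
    (hU : Measurable U) (hV : Measurable V) (hU2 : MemLp U 2 P) (hV2 : MemLp V 2 P)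
    (h : CondIndepFun m hm U V P) : P[fun ω => U ω * V ω | m] =ᵐ[P] fun ω => P[U|m] ω * P[V|m] ω := by
  have hh := ae_of_ae_trim hm ((condIndepFun_iff_map_prod_eq_prod_map_map hU hV).1 h)
  filter_upwards [hh, condExp_ae_eq_integral_condExpKernel hm (hU2.integrable_mul hV2),
    condExp_ae_eq_integral_condExpKernel hm (hU2.integrable (by norm_num)),
    condExp_ae_eq_integral_condExpKernel hm (hV2.integrable (by norm_num))] with ω h1 h2 h3 h4
  rw [h3, h4]
  refine h2.trans ?_
  have : IndepFun U V (condExpKernel P m ω) := by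
    rw [indepFun_iff_map_prod_eq_prod_map_map hU.aemeasurable hV.aemeasurable]
    rw [Kernel.map_apply _ (by fun_prop), Kernel.prod_apply, Kernel.map_apply _ hU,
      Kernel.map_apply _ hV] at h1
    exact h1
  exact this.integral_mul_eq_mul_integral hU.aestronglyMeasurable hV.aestronglyMeasurable

theorem aux_condExp {Ω : Type} [mΩ : MeasurableSpace Ω]
    (P : Measure Ω) [IsProbabilityMeasure P] (Y Z : Ω → ℝ)
    (hY : Measurable Y) (hZ : Measurable Z) (hG : HasGaussianLaw (fun ω => (Y ω, Z ω)) P)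
    (hv : Var[Z; P] ≠ 0) :
    P[Y | MeasurableSpace.comap Z inferInstance] =ᵐ[P] fun ω =>
      (cov[Y, Z; P] / Var[Z; P]) * Z ω + (P[Y] - (cov[Y, Z; P] / Var[Z; P]) * P[Z]) := by
  set a := cov[Y, Z; P] / Var[Z; P] with ha
  have hYi := hG.fst.integrable
  have hZi := hG.snd.integrable
  have hGU : HasGaussianLaw (fun ω => (Y ω - a * Z ω, Z ω)) P :=
    hG.map_fun ((ContinuousLinearMap.fst ℝ ℝ ℝ - a • ContinuousLinearMap.snd ℝ ℝ ℝ).prod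
      (ContinuousLinearMap.snd ℝ ℝ ℝ))
  have hind : IndepFun (fun ω => Y ω - a * Z ω) Z P := by
    refine hGU.indepFun_of_covariance_eq_zero ?_
    rw [covariance_fun_sub_left hG.fst.memLp_two (hG.snd.memLp_two.const_mul _) hG.snd.memLp_two,
      covariance_const_mul_left, covariance_self hZ.aemeasurable, ha]
    field_simp
    ring
  have hUm : Measurable (fun ω => Y ω - a * Z ω) := by fun_prop
  have h1 : P[fun ω => Y ω - a * Z ω | MeasurableSpace.comap Z inferInstance] =ᵐ[P]
      fun _ => ∫ ω, (Y ω - a * Z ω) ∂P :=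
    condExp_indep_eq hUm.comap_le hZ.comap_le (comap_measurable _).stronglyMeasurable hind
  have h2 : P[fun ω => a * Z ω | MeasurableSpace.comap Z inferInstance] = fun ω => a * Z ω :=
    condExp_of_stronglyMeasurable hZ.comap_le
      ((comap_measurable Z).const_mul a).stronglyMeasurable (hZi.const_mul a)
  have h3 : Y = (fun ω => Y ω - a * Z ω) + (fun ω => a * Z ω) := by ext; simp
  have h4 := condExp_add (hYi.sub (hZi.const_mul a)) (hZi.const_mul a)
    (MeasurableSpace.comap Z inferInstance)
  have h5 : ∫ ω, (Y ω - a * Z ω) ∂P = P[Y] - a * P[Z] := by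
    rw [integral_sub hYi (hZi.const_mul a), integral_const_mul]
  have h6 : P[Y | MeasurableSpace.comap Z inferInstance] =ᵐ[P]
      P[fun ω => Y ω - a * Z ω | MeasurableSpace.comap Z inferInstance] +
      P[fun ω => a * Z ω | MeasurableSpace.comap Z inferInstance] := by
    refine Filter.EventuallyEq.trans ?_ h4
    exact condExp_congr_ae (.of_forall fun ω => by simp)
  filter_upwards [h6, h1] with ω h6 h1
  rw [h6, Pi.add_apply, h1, h2, h5]
  ring

theorem aux_cov {Ω : Type} [mΩ : MeasurableSpace Ω] [StandardBorelSpace Ω]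
    (P : Measure Ω) [IsProbabilityMeasure P] (U V Z : Ω → ℝ)
    (hU : Measurable U) (hV : Measurable V) (hZ : Measurable Z)
    (hUZ : HasGaussianLaw (fun ω => (U ω, Z ω)) P) (hVZ : HasGaussianLaw (fun ω => (V ω, Z ω)) P)
    (hv : Var[Z; P] ≠ 0)
    (h : CondIndepFun (MeasurableSpace.comap Z inferInstance) hZ.comap_le U V P) :
    cov[U, V; P] * Var[Z; P] = cov[U, Z; P] * cov[V, Z; P] := by
  have hU2 := hUZ.fst.memLp_two
  have hV2 := hVZ.fst.memLp_two
  have hZ2 := hUZ.snd.memLp_two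
  have hZi := hUZ.snd.integrable
  have e1 := aux_prod _ P U V hZ.comap_le hU hV hU2 hV2 h
  have e2 := aux_condExp P U Z hU hZ hUZ hv
  have e3 := aux_condExp P V Z hV hZ hVZ hv
  set a := cov[U, Z; P] / Var[Z; P] with ha
  set b := cov[V, Z; P] / Var[Z; P] with hb
  set α := P[U] - a * P[Z] with hα
  set β := P[V] - b * P[Z] with hβ
  have hA2 : MemLp (fun ω => a * Z ω + α) 2 P := (hZ2.const_mul a).add (memLp_const α)
  have hB2 : MemLp (fun ω => b * Z ω + β) 2 P := (hZ2.const_mul b).add (memLp_const β)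
  have hEA : ∫ ω, (a * Z ω + α) ∂P = P[U] := by
    rw [integral_add (hZi.const_mul a) (integrable_const _), integral_const_mul]
    simp [hα]
  have hEB : ∫ ω, (b * Z ω + β) ∂P = P[V] := by
    rw [integral_add (hZi.const_mul b) (integrable_const _), integral_const_mul]
    simp [hβ]
  have hprod : ∫ ω, U ω * V ω ∂P = ∫ ω, (a * Z ω + α) * (b * Z ω + β) ∂P := by
    rw [← integral_condExp hZ.comap_le]
    refine integral_congr_ae ?_
    filter_upwards [e1, e2, e3] with ω e1 e2 e3
    rw [e1, e2, e3]
  have hcov : cov[U, V; P] = cov[fun ω => a * Z ω + α, fun ω => b * Z ω + β; P] := by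
    rw [covariance_eq_sub hU2 hV2, covariance_eq_sub hA2 hB2, hEA, hEB]
    congr 1
  have hc2 : cov[fun ω => a * Z ω + α, fun ω => b * Z ω + β; P] = a * b * Var[Z; P] := by
    rw [covariance_add_const_left (hZi.const_mul a), covariance_add_const_right (hZi.const_mul b),
      covariance_const_mul_left, covariance_const_mul_right, covariance_self hZ.aemeasurable]
    ring
  rw [hcov, hc2, ha, hb]
  field_simp

theorem aux_indep {Ω : Type} [mΩ : MeasurableSpace Ω]
    (P : Measure Ω) [IsProbabilityMeasure P] (U V Z : Ω → ℝ)
    (hG : HasGaussianLaw (fun ω => (U ω, (V ω, Z ω))) P)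
    (h1 : cov[U, V; P] = 0) (h2 : cov[U, Z; P] = 0) :
    IndepFun U (fun ω => (V ω, Z ω)) P := by
  refine hG.indepFun_of_covariance_strongDual fun L₁ L₂ => ?_
  have e1 : (L₁ ∘ U) = fun ω => L₁ 1 * U ω := by
    ext ω
    have := L₁.map_smul (U ω) 1
    simp only [smul_eq_mul, mul_one] at this
    simp [this, mul_comm]
  have e2 : (L₂ ∘ fun ω => (V ω, Z ω)) = fun ω => L₂ (1, 0) * V ω + L₂ (0, 1) * Z ω := by
    ext ω
    have h : ((V ω, Z ω) : ℝ × ℝ) = V ω • ((1, 0) : ℝ × ℝ) + Z ω • ((0, 1) : ℝ × ℝ) := by simp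
    simp only [Function.comp_apply]
    rw [h, map_add, map_smul, map_smul]
    simp [mul_comm]
  have hU := hG.fst.memLp_two
  have hV := hG.snd.fst.memLp_two
  have hZ := hG.snd.snd.memLp_two
  have e3 : (fun ω => L₂ (1, 0) * V ω + L₂ (0, 1) * Z ω) =
      (fun ω => L₂ (1, 0) * V ω) + (fun ω => L₂ (0, 1) * Z ω) := rfl
  rw [e1, e2, covariance_const_mul_left, e3, covariance_add_right hU (hV.const_mul _)
    (hZ.const_mul _), covariance_const_mul_right, covariance_const_mul_right, h1, h2]
  simp

theorem aux_cov_zero {Ω : Type} [mΩ : MeasurableSpace Ω]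
    (P : Measure Ω) [IsProbabilityMeasure P] (U Z : Ω → ℝ) (hZ : MemLp Z 2 P)
    (hv : Var[Z; P] = 0) : cov[U, Z; P] = 0 := by
  have h := ae_eq_integral_of_variance_eq_zero hZ hv
  rw [covariance]
  refine integral_eq_zero_of_ae ?_
  filter_upwards [h] with ω hω
  simp [hω]

/-- For a trivariate normal random vector `(X₁,X₂,X₃) ∼ N₃(μ, S)`, `S` positive definite:
`[X₁ ⊥⊥ X₂ and X₁ ⊥⊥ X₂ | X₃]` holds if and only if
`[X₁ ⊥⊥ (X₂,X₃) or X₂ ⊥⊥ (X₁,X₃)]` holds. -/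
theorem gaussian_marginal_and_conditional_indep_iff
    (μ : Fin 3 → ℝ) (S : Matrix (Fin 3) (Fin 3) ℝ) (hS : S.PosDef)
    (Ω : Type) [MeasurableSpace Ω] [StandardBorelSpace Ω]
    (P : Measure Ω) [IsProbabilityMeasure P]
    (X : Ω → (Fin 3 → ℝ)) (hX : Measurable X)
    (hlaw : Measure.map X P = mvNormal 3 μ S) :
    (IndepFun (fun ω => X ω 0) (fun ω => X ω 1) P ∧
      CondIndepFun (MeasurableSpace.comap (fun ω => X ω 2) inferInstance)
        (Measurable.comap_le ((measurable_pi_apply 2).comp hX))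
        (fun ω => X ω 0) (fun ω => X ω 1) P) ↔
    (IndepFun (fun ω => X ω 0) (fun ω => (X ω 1, X ω 2)) P ∨
      IndepFun (fun ω => X ω 1) (fun ω => (X ω 0, X ω 2)) P) := by
  have hprob : IsProbabilityMeasure (mvNormal 3 μ S) := by
    rw [← hlaw]; exact Measure.isProbabilityMeasure_map hX.aemeasurable
  have hG : HasGaussianLaw X P := ⟨by rw [hlaw]; exact aux_gauss 3 μ S hS hprob⟩
  have hm : ∀ i, Measurable (fun ω => X ω i) := fun i => (measurable_pi_apply i).comp hX
  have hG2 : ∀ i j, HasGaussianLaw (fun ω => (X ω i, X ω j)) P := fun i j =>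
    hG.map_fun ((ContinuousLinearMap.proj (R := ℝ) (φ := fun _ : Fin 3 => ℝ) i).prod
      (ContinuousLinearMap.proj j))
  have hG3 : ∀ i j k, HasGaussianLaw (fun ω => (X ω i, (X ω j, X ω k))) P := fun i j k =>
    hG.map_fun ((ContinuousLinearMap.proj (R := ℝ) (φ := fun _ : Fin 3 => ℝ) i).prod
      ((ContinuousLinearMap.proj j).prod (ContinuousLinearMap.proj k)))
  have hL : ∀ i, MemLp (fun ω => X ω i) 2 P := fun i => (hG2 i i).fst.memLp_two
  constructor
  · rintro ⟨h01, hc⟩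
    have c01 := h01.covariance_eq_zero (hL 0) (hL 1)
    by_cases hv : Var[fun ω => X ω 2; P] = 0
    · exact Or.inl (aux_indep P _ _ _ (hG3 0 1 2) c01 (aux_cov_zero P _ _ (hL 2) hv))
    · have h := aux_cov P _ _ _ (hm 0) (hm 1) (hm 2) (hG2 0 2) (hG2 1 2) hv hc
      rw [c01, zero_mul] at h
      rcases mul_eq_zero.1 h.symm with h | h
      · exact Or.inl (aux_indep P _ _ _ (hG3 0 1 2) c01 h)
      · exact Or.inr (aux_indep P _ _ _ (hG3 1 0 2) (by rw [covariance_comm]; exact c01) h)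
  · rintro (h | h)
    · exact ⟨h.comp measurable_id measurable_fst, aux_condIndep P _ _ _ (hm 0) (hm 1) (hm 2) h⟩
    · exact ⟨(h.comp measurable_id measurable_fst).symm,
        (aux_condIndep P _ _ _ (hm 1) (hm 0) (hm 2) h).symm⟩
end

section
/- Let Σ be a symmetric positive definite 4×4 real matrix. Then there exist ω ∈ ℝ⁴ with all entries strictly positive and λ ∈ ℝ⁴ such that Σ = diag(ω) + λλᵀ if and only if there exist ω̃ ∈ ℝ⁴ with all entries strictly positive and λ̃ ∈ ℝ⁴ such that Σ⁻¹ = diag(ω̃) − λ̃λ̃ᵀ. -/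
open Matrix

theorem key_mul (ω l : Fin 4 → ℝ) (hω : ∀ i, 0 < ω i) (e k : ℝ)
    (hk : k * (1 + e * ∑ i, l i * (l i / ω i)) = 1) :
    (Matrix.diagonal ω + e • Matrix.vecMulVec l l) *
      (Matrix.diagonal (fun i => (ω i)⁻¹) -
        (e * k) • Matrix.vecMulVec (fun i => l i / ω i) (fun i => l i / ω i)) = 1 := by
  have h1 : Matrix.diagonal ω * Matrix.diagonal (fun i => (ω i)⁻¹) = 1 := by
    rw [Matrix.diagonal_mul_diagonal, ← Matrix.diagonal_one]
    congr 1
    funext i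
    exact mul_inv_cancel₀ (hω i).ne'
  have h2 : Matrix.diagonal ω * Matrix.vecMulVec (fun i => l i / ω i) (fun i => l i / ω i)
      = Matrix.vecMulVec l (fun i => l i / ω i) := by
    ext i j
    have := (hω i).ne'
    rw [Matrix.diagonal_mul, Matrix.vecMulVec_apply, Matrix.vecMulVec_apply, ← mul_assoc,
      mul_div_cancel₀ _ this]
  have h3 : Matrix.vecMulVec l l * Matrix.diagonal (fun i => (ω i)⁻¹)
      = Matrix.vecMulVec l (fun i => l i / ω i) := by
    ext i j
    rw [Matrix.mul_diagonal, Matrix.vecMulVec_apply, Matrix.vecMulVec_apply, mul_assoc,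
      div_eq_mul_inv]
  have h4 : Matrix.vecMulVec l l * Matrix.vecMulVec (fun i => l i / ω i) (fun i => l i / ω i)
      = (∑ i, l i * (l i / ω i)) • Matrix.vecMulVec l (fun i => l i / ω i) := by
    ext i j
    rw [Matrix.mul_apply, Matrix.smul_apply, smul_eq_mul, Finset.sum_mul]
    refine Finset.sum_congr rfl fun x _ => ?_
    simp only [Matrix.vecMulVec_apply]
    ring
  rw [add_mul, mul_sub, mul_sub, h1, Matrix.mul_smul, h2, Matrix.smul_mul, h3,
    Matrix.smul_mul, Matrix.mul_smul, h4]
  ext i j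
  simp only [Matrix.add_apply, Matrix.sub_apply, Matrix.smul_apply, smul_eq_mul]
  linear_combination (-e * Matrix.vecMulVec l (fun i => l i / ω i) i j) * hk

theorem sqrt_smul (k : ℝ) (hk : 0 ≤ k) (m : Fin 4 → ℝ) :
    Matrix.vecMulVec (fun i => √k * m i) (fun i => √k * m i) = k • Matrix.vecMulVec m m := by
  ext i j
  simp only [Matrix.vecMulVec_apply, Matrix.smul_apply, smul_eq_mul]
  linear_combination (m i * m j) * Real.mul_self_sqrt hk

/-- A symmetric positive definite `4 × 4` matrix `Σ` has a one-factor factor analysis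
decomposition `Σ = diag(ω) + λλᵀ` with `ω > 0` entrywise if and only if its inverse has a
decomposition `Σ⁻¹ = diag(ω̃) − λ̃λ̃ᵀ` with `ω̃ > 0` entrywise. -/
theorem factor_analysis_parametrization_iff
    (S : Matrix (Fin 4) (Fin 4) ℝ) (hS : S.PosDef) :
    (∃ (ω l : Fin 4 → ℝ), (∀ i, 0 < ω i) ∧
        S = Matrix.diagonal ω + Matrix.vecMulVec l l) ↔
      (∃ (ω l : Fin 4 → ℝ), (∀ i, 0 < ω i) ∧
        S⁻¹ = Matrix.diagonal ω - Matrix.vecMulVec l l) := by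
  constructor
  · rintro ⟨ω, l, hω, rfl⟩
    have hs : 0 ≤ ∑ i, l i * (l i / ω i) := Finset.sum_nonneg fun i _ => by
      rw [← mul_div_assoc]
      exact div_nonneg (mul_self_nonneg _) (hω i).le
    have hp : 0 < 1 + ∑ i, l i * (l i / ω i) := by linarith
    refine ⟨fun i => (ω i)⁻¹, fun i => √((1 + ∑ i, l i * (l i / ω i))⁻¹) * (l i / ω i),
      fun i => inv_pos.2 (hω i), ?_⟩
    rw [sqrt_smul _ (inv_pos.2 hp).le]
    apply Matrix.inv_eq_right_inv
    have := key_mul ω l hω 1 (1 + ∑ i, l i * (l i / ω i))⁻¹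
      (by rw [one_mul]; exact inv_mul_cancel₀ hp.ne')
    simpa only [one_smul, one_mul] using this
  · rintro ⟨ω, l, hω, h⟩
    have hp : 0 < 1 - ∑ i, l i * (l i / ω i) := by
      by_cases hx : (fun i => l i / ω i) = 0
      · have : ∀ i, l i / ω i = 0 := fun i => congrFun hx i
        simp [this]
      · have h0 := hS.inv.dotProduct_mulVec_pos hx
        have e1 : (S⁻¹ *ᵥ (fun i => l i / ω i)) =
            fun i => l i * (1 - ∑ i, l i * (l i / ω i)) := by
          rw [h, Matrix.sub_mulVec]
          funext i
          rw [Pi.sub_apply, Matrix.mulVec_diagonal, mul_div_cancel₀ _ (hω i).ne', mul_sub,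
            mul_one, Finset.mul_sum]
          simp only [Matrix.mulVec, dotProduct, Matrix.vecMulVec_apply, mul_assoc]
        have e2 : star (fun i => l i / ω i) ⬝ᵥ (S⁻¹ *ᵥ (fun i => l i / ω i)) =
            (∑ i, l i * (l i / ω i)) * (1 - ∑ i, l i * (l i / ω i)) := by
          rw [e1, Finset.sum_mul]
          simp only [dotProduct, Pi.star_apply, star_trivial]
          exact Finset.sum_congr rfl fun i _ => by ring
        rw [e2] at h0
        have hs : 0 ≤ ∑ i, l i * (l i / ω i) := Finset.sum_nonneg fun i _ => by
          rw [← mul_div_assoc]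
          exact div_nonneg (mul_self_nonneg _) (hω i).le
        exact pos_of_mul_pos_right h0 hs
    refine ⟨fun i => (ω i)⁻¹, fun i => √((1 - ∑ i, l i * (l i / ω i))⁻¹) * (l i / ω i),
      fun i => inv_pos.2 (hω i), ?_⟩
    rw [sqrt_smul _ (inv_pos.2 hp).le]
    have hdet : IsUnit S.det := (Matrix.isUnit_iff_isUnit_det S).1 hS.isUnit
    rw [← Matrix.nonsing_inv_nonsing_inv S hdet, h]
    apply Matrix.inv_eq_right_inv
    have := key_mul ω l hω (-1) (1 - ∑ i, l i * (l i / ω i))⁻¹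
      (by rw [neg_one_mul, ← sub_eq_add_neg]; exact inv_mul_cancel₀ hp.ne')
    simpa only [neg_smul, one_smul, neg_mul, one_mul, sub_neg_eq_add, ← sub_eq_add_neg] using this
end

section
/- For ε > 0 let M(ε) be the 4×4 matrix (1/(8(1+ε))) · [[1,1,ε,ε],[ε,1,1,ε],[ε,ε,1,1],[1,ε,ε,1]]. Then there exists ε₀ > 0 such that for all 0 < ε < ε₀: (i) M(ε) has nonnegative entries summing to 1; (ii) det M(ε) = 0 and M(ε) has rank exactly 3; and (iii) there do not exist vectors a₁,a₂,a₃,b₁,b₂,b₃ ∈ ℝ⁴ with all entries nonnegative such that M(ε) = a₁b₁ᵀ + a₂b₂ᵀ + a₃b₃ᵀ. In particular, M(ε) is not the (X₁,X₂)-marginal of any joint distribution of discrete variables (X₁,X₂,X₃) with X₁,X₂ taking 4 values, X₃ taking 3 values, and X₁ ⊥⊥ X₂ | X₃. -/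
open Matrix

/-- The matrix `M(ε) = (1/(8(1+ε))) · [[1,1,ε,ε],[ε,1,1,ε],[ε,ε,1,1],[1,ε,ε,1]]`. -/
noncomputable def Mmat (ε : ℝ) : Matrix (Fin 4) (Fin 4) ℝ :=
  (1 / (8 * (1 + ε))) • !![1, 1, ε, ε; ε, 1, 1, ε; ε, ε, 1, 1; 1, ε, ε, 1]

theorem Mmat_apply_formula (ε : ℝ) (i j : Fin 4) : Mmat ε i j =
    1 / (8 * (1 + ε)) *
      (!![1, 1, ε, ε; ε, 1, 1, ε; ε, ε, 1, 1; 1, ε, ε, 1] : Matrix (Fin 4) (Fin 4) ℝ) i j := by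
  simp [Mmat]

/-- Quantitative fooling-set argument along the diagonal. -/
theorem no_three_term (ε : ℝ) (h0 : 0 < ε) (h1 : ε < 1 / 10)
    (T : Fin 3 → Fin 4 → Fin 4 → ℝ) (hT : ∀ r i j, 0 ≤ T r i j)
    (hm : ∀ r i j, T r i i * T r j j = T r i j * T r j i)
    (hs : ∀ i j, Mmat ε i j = ∑ r, T r i j) : False := by
  obtain ⟨c, hc⟩ : ∃ c : ℝ, c = 1 / (8 * (1 + ε)) := ⟨_, rfl⟩
  have hcpos : 0 < c := by rw [hc]; positivity
  have hdiag : ∀ i, ∃ r, c / 3 ≤ T r i i := by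
    intro i
    by_contra! hcon
    have h := hs i i
    have hd : Mmat ε i i = c := by
      rw [Mmat_apply_formula, hc]; fin_cases i <;> simp
    rw [hd, Fin.sum_univ_three] at h
    linarith [hcon 0, hcon 1, hcon 2]
  choose f hf using hdiag
  obtain ⟨i, j, hij, hfij⟩ := Fintype.exists_ne_map_eq_of_card_lt f (by simp)
  have hle : ∀ r i j, T r i j ≤ Mmat ε i j := by
    intro r i j
    rw [hs i j]
    exact Finset.single_le_sum (f := fun r => T r i j) (fun r _ => hT r i j) (Finset.mem_univ r)
  have hprod : Mmat ε i j * Mmat ε j i ≤ c ^ 2 * ε := by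
    have key : (!![1, 1, ε, ε; ε, 1, 1, ε; ε, ε, 1, 1; 1, ε, ε, 1] :
        Matrix (Fin 4) (Fin 4) ℝ) i j * (!![1, 1, ε, ε; ε, 1, 1, ε; ε, ε, 1, 1; 1, ε, ε, 1] :
        Matrix (Fin 4) (Fin 4) ℝ) j i ≤ ε := by
      fin_cases i <;> fin_cases j <;> simp at hij ⊢ <;> nlinarith
    rw [Mmat_apply_formula, Mmat_apply_formula, ← hc]
    nlinarith [sq_nonneg c]
  have hi := hf i
  have hj := hf j
  rw [← hfij] at hj
  have e1 : c / 3 * (c / 3) ≤ T (f i) i i * T (f i) j j :=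
    mul_le_mul hi hj (by positivity) (hT _ _ _)
  rw [hm] at e1
  have e2 : T (f i) i j * T (f i) j i ≤ Mmat ε i j * Mmat ε j i :=
    mul_le_mul (hle _ _ _) (hle _ _ _) (hT _ _ _) ((hT (f i) i j).trans (hle _ _ _))
  have hc2 : 0 < c ^ 2 := by positivity
  nlinarith

theorem Mmat_rank_eq (ε : ℝ) (h0 : 0 < ε) (h1 : ε < 1 / 10) : (Mmat ε).rank = 3 := by
  have hcpos : 0 < 1 / (8 * (1 + ε)) := by positivity
  apply le_antisymm
  · have hfac : Mmat ε = (!![1, 0, 0; 0, 1, 0; 0, 0, 1; 1, -1, 1] : Matrix (Fin 4) (Fin 3) ℝ) *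
        (Mmat ε).submatrix ![0, 1, 2] id := by
      ext i j
      rw [Matrix.mul_apply, Fin.sum_univ_three]
      simp only [Matrix.submatrix_apply, Mmat_apply_formula]
      fin_cases i <;> fin_cases j <;> simp
    rw [hfac]
    exact (Matrix.rank_mul_le_left _ _).trans (Matrix.rank_le_width _)
  · have hdet : ((Mmat ε).submatrix ![0, 1, 2] ![0, 1, 2]).det ≠ 0 := by
      have : ((Mmat ε).submatrix ![0, 1, 2] ![0, 1, 2]).det =
          (1 / (8 * (1 + ε))) ^ 3 * ((1 - ε) * (1 - ε ^ 2)) := by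
        rw [Matrix.det_fin_three]
        simp only [Matrix.submatrix_apply, Mmat_apply_formula]
        generalize 1 / (8 * (1 + ε)) = c
        simp
        ring
      rw [this]
      have : 0 < 1 - ε := by linarith
      have : 0 < 1 - ε ^ 2 := by nlinarith
      positivity
    have h := Matrix.rank_of_det_ne_zero hdet
    rw [Fintype.card_fin] at h
    exact h.ge.trans (Matrix.rank_submatrix_le _ _ _)

/-- For all sufficiently small `ε > 0`: `M(ε)` is a probability matrix of determinant zero
and rank exactly `3` which admits no decomposition as a sum of three nonnegative rank-one
matrices; in particular, `M(ε)` is not the `(X₁,X₂)`-marginal of any joint distribution of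
discrete variables `(X₁,X₂,X₃)` with `X₁, X₂` taking 4 values, `X₃` taking 3 values and
`X₁ ⊥⊥ X₂ | X₃`. -/
theorem Mmat_not_in_marginalized_model :
    ∃ ε₀ > (0 : ℝ), ∀ ε : ℝ, 0 < ε → ε < ε₀ →
      (∀ i j, 0 ≤ Mmat ε i j) ∧ (∑ i, ∑ j, Mmat ε i j = 1) ∧
      (Mmat ε).det = 0 ∧ (Mmat ε).rank = 3 ∧
      (¬ ∃ a b : Fin 3 → Fin 4 → ℝ, (∀ r i, 0 ≤ a r i) ∧ (∀ r j, 0 ≤ b r j) ∧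
        Mmat ε = ∑ r, Matrix.vecMulVec (a r) (b r)) ∧
      (¬ ∃ q : Fin 4 → Fin 4 → Fin 3 → ℝ, (∀ i j k, 0 ≤ q i j k) ∧
        (∑ i, ∑ j, ∑ k, q i j k = 1) ∧
        (∀ (i₁ i₂ : Fin 4) (j₁ j₂ : Fin 4) (k : Fin 3),
          q i₁ j₁ k * q i₂ j₂ k = q i₁ j₂ k * q i₂ j₁ k) ∧
        ∀ i j, Mmat ε i j = ∑ k, q i j k) := by
  refine ⟨1 / 10, by norm_num, fun ε h0 h1 => ⟨?_, ?_, ?_, Mmat_rank_eq ε h0 h1, ?_, ?_⟩⟩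
  · intro i j
    rw [Mmat_apply_formula]
    have hc : 0 ≤ 1 / (8 * (1 + ε)) := by positivity
    refine mul_nonneg hc ?_
    fin_cases i <;> fin_cases j <;> simp <;> exact h0.le
  · have h2 : 1 + ε ≠ 0 := by positivity
    simp only [Fin.sum_univ_four, Mmat_apply_formula]
    simp
    field_simp
    ring
  · by_contra hdet
    have h := Matrix.rank_of_det_ne_zero hdet
    rw [Mmat_rank_eq ε h0 h1] at h
    simp at h
  · rintro ⟨a, b, ha, hb, hM⟩
    refine no_three_term ε h0 h1 (fun r i j => a r i * b r j)
      (fun r i j => mul_nonneg (ha r i) (hb r j)) (fun r i j => by ring) (fun i j => ?_)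
    rw [hM, Matrix.sum_apply]
    simp [Matrix.vecMulVec_apply]
  · rintro ⟨q, hq, -, hm, hM⟩
    exact no_three_term ε h0 h1 (fun r i j => q i j r) (fun r i j => hq i j r)
      (fun r i j => hm i j i j r) hM
end
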